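/- arXiv:2307.15868 — 10 statements merged into one kernel-verified Lean document; each statement's English description precedes it below -/
import Mathlib

section
/- Let f : ℝ^{d_x} × ℝ^{d_y} → ℝ be differentiable and satisfy the two-sided PL condition with constants μ_x, μ_y > 0, and assume that for every y the infimum inf_x f(x,y) is attained and for every x the supremum sup_y f(x,y) is attained. Then f satisfies the quadratic growth condition: for all x, y, f(x,y) − min_{x'} f(x',y) ≥ (μ_x/2) · dist(x, argmin_{x'} f(x',y))² and max_{y'} f(x,y') − f(x,y) ≥ (μ_y/2) · dist(y, argmax_{y'} f(x,y'))², where dist denotes the Euclidean distance from a point to a set. -/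
noncomputable section

/-- A differentiable function `h : ℝ^d → ℝ` is `μ`-PL if its infimum is finite and
`‖∇h(z)‖² ≥ 2μ(h(z) − inf h)` for all `z`. -/
def IsPL {d : ℕ} (h : EuclideanSpace ℝ (Fin d) → ℝ) (μ : ℝ) : Prop :=
  Differentiable ℝ h ∧ BddBelow (Set.range h) ∧
    ∀ z, 2 * μ * (h z - ⨅ z', h z') ≤ ‖gradient h z‖ ^ 2

/-- `f` is `L`-smooth: it is (jointly) differentiable and its gradient is `L`-Lipschitz in the
product (ℓ²) norm: `‖∇f(x,y) − ∇f(x',y')‖² ≤ L²(‖x−x'‖² + ‖y−y'‖²)`. -/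
def LSmooth {dx dy : ℕ} (f : EuclideanSpace ℝ (Fin dx) → EuclideanSpace ℝ (Fin dy) → ℝ)
    (L : ℝ) : Prop :=
  Differentiable ℝ (fun p : EuclideanSpace ℝ (Fin dx) × EuclideanSpace ℝ (Fin dy) => f p.1 p.2) ∧
    ∀ x x' y y',
      ‖gradient (fun x'' => f x'' y) x - gradient (fun x'' => f x'' y') x'‖ ^ 2 +
          ‖gradient (f x) y - gradient (f x') y'‖ ^ 2 ≤
        L ^ 2 * (‖x - x'‖ ^ 2 + ‖y - y'‖ ^ 2)

/-- Two-sided PL condition: `f(·,y)` is `μx`-PL for every `y` and `−f(x,·)` is `μy`-PL for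
every `x`. -/
def TwoSidedPL {dx dy : ℕ} (f : EuclideanSpace ℝ (Fin dx) → EuclideanSpace ℝ (Fin dy) → ℝ)
    (μx μy : ℝ) : Prop :=
  (∀ y, IsPL (fun x => f x y) μx) ∧ (∀ x, IsPL (fun y => -f x y) μy)

/-- `p = (x̄, ȳ)` is a saddle point of `f`: `f(x̄, y) ≤ f(x̄, ȳ) ≤ f(x, ȳ)` for all `x, y`. -/
def IsSaddle {dx dy : ℕ} (f : EuclideanSpace ℝ (Fin dx) → EuclideanSpace ℝ (Fin dy) → ℝ)
    (p : EuclideanSpace ℝ (Fin dx) × EuclideanSpace ℝ (Fin dy)) : Prop :=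
  ∀ x y, f p.1 y ≤ f p.1 p.2 ∧ f p.1 p.2 ≤ f x p.2

/-- If `g` has gradient `v` at `z` and decreases from `z` at rate at most `c`, then `‖v‖ ≤ c`. -/
theorem norm_gradient_le_of_forall_sub_le {E : Type*} [NormedAddCommGroup E]
    [InnerProductSpace ℝ E] [CompleteSpace E] {g : E → ℝ} {v z : E} {c : ℝ} (hc : 0 ≤ c)
    (hg : HasGradientAt g v z) (h : ∀ w, g z - c * ‖w - z‖ ≤ g w) : ‖v‖ ≤ c := by
  have hline : HasDerivAt (fun t : ℝ => z + t • (-v)) (-v) 0 := by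
    simpa using ((hasDerivAt_id (0 : ℝ)).smul_const (-v)).const_add z
  have hg' : HasFDerivAt g (InnerProductSpace.toDual ℝ E v) (z + (0 : ℝ) • (-v)) := by
    simpa using hg.hasFDerivAt
  have hd := (hg'.comp_hasDerivAt (0 : ℝ) hline).tendsto_slope_zero_right
  have hle : -(c * ‖v‖) ≤ InnerProductSpace.toDual ℝ E v (-v) := by
    refine ge_of_tendsto hd ?_
    filter_upwards [self_mem_nhdsWithin] with t ht
    have ht : 0 < t := ht
    have h1 := h (z + t • (-v))
    rw [add_sub_cancel_left, norm_smul, norm_neg, Real.norm_of_nonneg ht.le] at h1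
    simp only [Function.comp_apply, zero_add, zero_smul, add_zero, smul_eq_mul]
    rw [inv_mul_eq_div, le_div_iff₀ ht]
    linarith
  rw [InnerProductSpace.toDual_apply_apply, inner_neg_right, real_inner_self_eq_norm_sq] at hle
  nlinarith [norm_nonneg v]

/-- If a nonnegative continuous function on a proper space has gradient of norm at least `c` off
its zero set, it dominates `c` times the distance to that set. -/
theorem mul_infDist_le_of_le_norm_gradient {E : Type*} [NormedAddCommGroup E]
    [InnerProductSpace ℝ E] [ProperSpace E] {g : E → ℝ} {c : ℝ}
    (hg : Continuous g) (hg0 : ∀ z, 0 ≤ g z)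
    (hgrad : ∀ z, g z ≠ 0 → ∃ v, HasGradientAt g v z ∧ c ≤ ‖v‖) (x : E) :
    c * Metric.infDist x {z | g z = 0} ≤ g x := by
  by_contra! hlt
  have hD : 0 < Metric.infDist x {z | g z = 0} := by
    refine lt_of_le_of_ne Metric.infDist_nonneg fun h => ?_
    rw [← h, mul_zero] at hlt
    exact hlt.not_ge (hg0 x)
  obtain ⟨b, hb, hbc⟩ := exists_between ((div_lt_iff₀ hD).2 hlt)
  have hb0 : 0 < b := (div_nonneg (hg0 x) hD.le).trans_lt hb
  obtain ⟨z, hz⟩ := Continuous.exists_forall_le (f := fun z => g z + b * dist z x)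
    (by fun_prop)
    (Filter.tendsto_atTop_mono (fun z => le_add_of_nonneg_left (hg0 z))
      ((tendsto_dist_right_cocompact_atTop x).const_mul_atTop hb0))
  by_cases hz0 : g z = 0
  · have h1 := hz x
    rw [dist_self, mul_zero, add_zero, hz0, zero_add] at h1
    have h2 : Metric.infDist x {z | g z = 0} ≤ dist z x := by
      rw [dist_comm]
      exact Metric.infDist_le_dist_of_mem hz0
    have h3 := (div_lt_iff₀ hD).1 hb
    nlinarith
  · obtain ⟨v, hv, hcv⟩ := hgrad z hz0
    refine (hbc.trans_le hcv).not_ge (norm_gradient_le_of_forall_sub_le hb0.le hv fun w => ?_)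
    have h1 := hz w
    have h2 := dist_triangle w z x
    rw [dist_eq_norm w z] at h2
    nlinarith

/-- A PL function whose infimum is attained has quadratic growth. -/
theorem IsPL.mul_infDist_sq_le {d : ℕ} {h : EuclideanSpace ℝ (Fin d) → ℝ} {μ : ℝ} (hμ : 0 < μ)
    (hPL : IsPL h μ) (hmin : ∃ z, ∀ z', h z ≤ h z') (x : EuclideanSpace ℝ (Fin d)) :
    μ / 2 * Metric.infDist x {z | ∀ z', h z ≤ h z'} ^ 2 ≤ h x - ⨅ z, h z := by
  obtain ⟨hdiff, hbdd, hineq⟩ := hPL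
  obtain ⟨z₀, hz₀⟩ := hmin
  set m := ⨅ z, h z with hm
  have hle : ∀ z, m ≤ h z := fun z => ciInf_le hbdd z
  have hmz : m = h z₀ := le_antisymm (hle z₀) (le_ciInf hz₀)
  have hset : {z | ∀ z', h z ≤ h z'} = {z | √(h z - m) = 0} := by
    ext z
    simp only [Set.mem_ofPred_eq]
    rw [Real.sqrt_eq_zero (sub_nonneg.2 (hle z)), sub_eq_zero]
    exact ⟨fun H => le_antisymm (hmz ▸ H z₀) (hle z), fun H z' => H ▸ hle z'⟩
  have key := mul_infDist_le_of_le_norm_gradient (g := fun z => √(h z - m)) (c := √(μ / 2))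
    ((hdiff.continuous.sub continuous_const).sqrt) (fun z => Real.sqrt_nonneg _) (fun z hz => by
      have hs : 0 < √(h z - m) := lt_of_le_of_ne (Real.sqrt_nonneg _) (Ne.symm hz)
      have hpos : 0 < h z - m := Real.sqrt_pos.1 hs
      refine ⟨(1 / (2 * √(h z - m))) • gradient h z, ?_, ?_⟩
      · rw [hasGradientAt_iff_hasFDerivAt, map_smul]
        exact ((hdiff z).hasGradientAt.hasFDerivAt.sub_const m).sqrt hpos.ne'
      · rw [norm_smul, Real.norm_of_nonneg (by positivity)]
        refine Real.sqrt_le_iff.2 ⟨by positivity, ?_⟩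
        rw [mul_pow, div_pow, mul_pow, Real.sq_sqrt hpos.le, one_pow, one_div_mul_eq_div,
          le_div_iff₀ (by positivity)]
        linarith [hineq z]) x
  rw [hset]
  have h2 := pow_le_pow_left₀ (mul_nonneg (Real.sqrt_nonneg _) Metric.infDist_nonneg) key 2
  rwa [mul_pow, Real.sq_sqrt (by positivity), Real.sq_sqrt (sub_nonneg.2 (hle x))] at h2

theorem stmt1 {dx dy : ℕ} (f : EuclideanSpace ℝ (Fin dx) → EuclideanSpace ℝ (Fin dy) → ℝ)
    (μx μy : ℝ) (hμx : 0 < μx) (hμy : 0 < μy)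
    (hdiff : Differentiable ℝ (fun p : EuclideanSpace ℝ (Fin dx) × EuclideanSpace ℝ (Fin dy) => f p.1 p.2))
    (hPL : TwoSidedPL f μx μy)
    (hmin : ∀ y, ∃ x, ∀ x', f x y ≤ f x' y)
    (hmax : ∀ x, ∃ y, ∀ y', f x y' ≤ f x y) :
    ∀ x y,
      μx / 2 * Metric.infDist x {x' | ∀ x'', f x' y ≤ f x'' y} ^ 2 ≤ f x y - ⨅ x', f x' y ∧
      μy / 2 * Metric.infDist y {y' | ∀ y'', f x y'' ≤ f x y'} ^ 2 ≤ (⨆ y', f x y') - f x y := by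
  intro x y
  refine ⟨(hPL.1 y).mul_infDist_sq_le hμx (hmin y) x, ?_⟩
  have hy := (hPL.2 x).mul_infDist_sq_le hμy (by simpa using hmax x) y
  obtain ⟨y₀, hy₀⟩ := hmax x
  have hsup : ⨆ y', f x y' = f x y₀ :=
    le_antisymm (ciSup_le hy₀) (le_ciSup (f := f x) ⟨f x y₀, Set.forall_mem_range.2 hy₀⟩ y₀)
  have hinf : ⨅ y', -f x y' = -f x y₀ :=
    le_antisymm (ciInf_le (hPL.2 x).2.1 y₀) (le_ciInf fun y' => neg_le_neg (hy₀ y'))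
  simp only [neg_le_neg_iff] at hy
  rw [hinf] at hy
  rw [hsup]
  linarith
end
end

section
/- Let f : ℝ^{d_x} × ℝ^{d_y} → ℝ be differentiable and satisfy the two-sided PL condition with constants μ_x, μ_y > 0. Let g(x) := sup_y f(x,y); assume this supremum is attained for every x and g* := inf_x g(x) is finite. Assume g is differentiable and ∇g(x) = ∇_x f(x, ŷ) for every x and every maximizer ŷ of f(x, ·). Then g is μ_x-PL, i.e. ‖∇g(x)‖² ≥ 2μ_x (g(x) − g*) for all x. -/
noncomputable section

theorem stmt2 {dx dy : ℕ} (f : EuclideanSpace ℝ (Fin dx) → EuclideanSpace ℝ (Fin dy) → ℝ)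
    (μx μy : ℝ) (hμx : 0 < μx) (hμy : 0 < μy)
    (hdiff : Differentiable ℝ (fun p : EuclideanSpace ℝ (Fin dx) × EuclideanSpace ℝ (Fin dy) => f p.1 p.2))
    (hPL : TwoSidedPL f μx μy)
    (g : EuclideanSpace ℝ (Fin dx) → ℝ) (hg : ∀ x, g x = ⨆ y, f x y)
    (hatt : ∀ x, ∃ y, ∀ y', f x y' ≤ f x y)
    (hbdd : BddBelow (Set.range g))
    (hgdiff : Differentiable ℝ g)
    (hgrad : ∀ x y, (∀ y', f x y' ≤ f x y) →
      gradient g x = gradient (fun x' => f x' y) x) :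
    ∀ x, 2 * μx * (g x - ⨅ x', g x') ≤ ‖gradient g x‖ ^ 2 := by
  have f_le_g : ∀ x y, f x y ≤ g x := fun x y => by
    obtain ⟨y₀, hy₀⟩ := hatt x
    rw [hg x]
    exact le_ciSup ⟨f x y₀, Set.forall_mem_range.2 hy₀⟩ y
  intro x
  obtain ⟨y, hy⟩ := hatt x
  obtain ⟨-, hbelow, hineq⟩ := hPL.1 y
  have g_le : g x ≤ f x y := (hg x).trans_le (ciSup_le hy)
  have inf_le : ⨅ x', f x' y ≤ ⨅ x', g x' := ciInf_mono hbelow fun x' => f_le_g x' y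
  calc 2 * μx * (g x - ⨅ x', g x') ≤ 2 * μx * (f x y - ⨅ x', f x' y) := by gcongr
    _ ≤ ‖gradient (fun x' => f x' y) x‖ ^ 2 := hineq x
    _ = ‖gradient g x‖ ^ 2 := by rw [hgrad x y hy]
end
end

section
/- Let f : ℝ^{d_x} × ℝ^{d_y} → ℝ be L-smooth (L > 0) and satisfy the two-sided PL condition with constants μ_x, μ_y > 0. Let g(x) := sup_y f(x,y); assume this supremum is attained for every x. Assume g is differentiable and ∇g(x) = ∇_x f(x, ŷ) for every x and every maximizer ŷ of f(x, ·). Then for all x and y, ‖∇_x f(x,y) − ∇g(x)‖² ≤ (2L²/μ_y) (g(x) − f(x,y)). -/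
noncomputable section

/-- Quadratic growth of PL functions: every constant below the sharp one is realized by some
minimizer. -/
theorem IsPL.exists_minimizer {d : ℕ} {h : EuclideanSpace ℝ (Fin d) → ℝ} {μ c : ℝ}
    (hh : IsPL h μ) (hc : 0 < c) (hcμ : 2 * c ^ 2 < μ) (z₀ : EuclideanSpace ℝ (Fin d)) :
    ∃ z, (∀ w, h z ≤ h w) ∧ c ^ 2 * ‖z - z₀‖ ^ 2 ≤ h z₀ - h z := by
  obtain ⟨hd, hbdd, hPL⟩ := hh
  set m := ⨅ z, h z
  have hm : ∀ z, m ≤ h z := fun z => ciInf_le hbdd z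
  have hcont : Continuous fun z => √(h z - m) + c * dist z z₀ := by
    have := hd.continuous
    fun_prop
  have hlim : Filter.Tendsto (fun z => √(h z - m) + c * dist z z₀)
      (Filter.cocompact (EuclideanSpace ℝ (Fin d))) Filter.atTop :=
    Filter.tendsto_atTop_mono (fun z => le_add_of_nonneg_left (Real.sqrt_nonneg _))
      ((tendsto_dist_right_cocompact_atTop z₀).const_mul_atTop hc)
  obtain ⟨z, hz⟩ := hcont.exists_forall_le hlim
  have hmz : h z = m := by
    refine le_antisymm (not_lt.1 fun hlt => ?_) (hm z)
    have hpos : 0 < h z - m := sub_pos.2 hlt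
    set v := gradient h z
    -- The derivative at `0` of the penalized objective along `-v` must be nonnegative.
    have hline : HasDerivAt (fun t : ℝ => z - t • v) (-v) 0 := by
      simpa using ((hasDerivAt_id (0 : ℝ)).smul_const v).const_sub z
    have hderiv : HasDerivAt (fun t : ℝ => h (z - t • v)) (-‖v‖ ^ 2) 0 := by
      have hg : HasFDerivAt h (InnerProductSpace.toDual ℝ _ v) (z - (0 : ℝ) • v) := by
        rw [zero_smul, sub_zero]
        exact (hd z).hasGradientAt.hasFDerivAt
      simpa [real_inner_self_eq_norm_sq, Function.comp_def] using hg.comp_hasDerivAt (0 : ℝ) hline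
    have hF : HasDerivAt (fun t : ℝ => √(h (z - t • v) - m) + c * (t * ‖v‖))
        (-‖v‖ ^ 2 / (2 * √(h z - m)) + c * ‖v‖) 0 := by
      have h1 := (hderiv.sub_const m).sqrt (by simpa using hpos.ne')
      have h2 := ((hasDerivAt_id (0 : ℝ)).mul_const ‖v‖).const_mul c
      simpa using h1.fun_add h2
    have hmin : IsMinOn (fun t : ℝ => √(h (z - t • v) - m) + c * (t * ‖v‖)) (Set.Ici 0) 0 := by
      intro t ht
      have ht : 0 ≤ t := ht
      have h1 := hz (z - t • v)
      have h2 : dist (z - t • v) z₀ ≤ t * ‖v‖ + dist z z₀ := by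
        refine (dist_triangle _ z _).trans_eq ?_
        simp [dist_eq_norm, norm_smul, abs_of_nonneg ht]
      simp only [Set.mem_ofPred_eq, zero_smul, sub_zero, zero_mul, mul_zero, add_zero]
      nlinarith
    have hnonneg : 0 ≤ -‖v‖ ^ 2 / (2 * √(h z - m)) + c * ‖v‖ := by
      have := hmin.localize.hasFDerivWithinAt_nonneg hF.hasFDerivAt.hasFDerivWithinAt
        (y := (1 : ℝ)) (mem_posTangentConeAt_of_segment_subset
          ((convex_Ici (0 : ℝ)).segment_subset (by simp) (by simp)))
      simpa using this
    have hs : 0 < √(h z - m) := Real.sqrt_pos.2 hpos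
    have hsq : √(h z - m) ^ 2 = h z - m := Real.sq_sqrt hpos.le
    have hle : ‖v‖ ^ 2 ≤ c * ‖v‖ * (2 * √(h z - m)) := by
      rw [← div_le_iff₀ (by positivity)]
      rw [neg_div] at hnonneg
      linarith
    have hv := hPL z
    change 2 * μ * (h z - m) ≤ ‖v‖ ^ 2 at hv
    nlinarith [sq_nonneg (‖v‖ - 2 * c * √(h z - m)), mul_pos (sub_pos.2 hcμ) hpos]
  refine ⟨z, fun w => hmz ▸ hm w, ?_⟩
  have h1 : c * ‖z - z₀‖ ≤ √(h z₀ - m) := by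
    simpa [hmz, dist_eq_norm] using hz z₀
  rw [← mul_pow, hmz]
  exact (Real.le_sqrt (by positivity) (sub_nonneg.2 (hm z₀))).1 h1

theorem stmt3 {dx dy : ℕ} (f : EuclideanSpace ℝ (Fin dx) → EuclideanSpace ℝ (Fin dy) → ℝ)
    (L μx μy : ℝ) (hL : 0 < L) (hμx : 0 < μx) (hμy : 0 < μy)
    (hsmooth : LSmooth f L)
    (hPL : TwoSidedPL f μx μy)
    (g : EuclideanSpace ℝ (Fin dx) → ℝ) (hg : ∀ x, g x = ⨆ y, f x y)
    (hatt : ∀ x, ∃ y, ∀ y', f x y' ≤ f x y)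
    (hgdiff : Differentiable ℝ g)
    (hgrad : ∀ x y, (∀ y', f x y' ≤ f x y) →
      gradient g x = gradient (fun x' => f x' y) x) :
    ∀ x y, ‖gradient (fun x' => f x' y) x - gradient g x‖ ^ 2 ≤
      2 * L ^ 2 / μy * (g x - f x y) := by
  intro x y
  set A := ‖gradient (fun x' => f x' y) x - gradient g x‖ ^ 2
  have key : ∀ b, 0 < b → b < μy → b * A ≤ 2 * L ^ 2 * (g x - f x y) := by
    intro b hb hbμ
    have hsq : √(b / 2) ^ 2 = b / 2 := Real.sq_sqrt (by positivity)
    obtain ⟨y', hmax, hgrowth⟩ := (hPL.2 x).exists_minimizer (c := √(b / 2))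
      (Real.sqrt_pos.2 (by positivity)) (by rw [hsq]; linarith) y
    have hmax' : ∀ w, f x w ≤ f x y' := fun w => neg_le_neg_iff.1 (hmax w)
    have hgx : g x = f x y' := by
      rw [hg]
      exact le_antisymm (ciSup_le hmax') (le_ciSup ⟨_, Set.forall_mem_range.2 hmax'⟩ y')
    have hlip := hsmooth.2 x x y y'
    rw [← hgrad x y' hmax', sub_self, norm_zero, norm_sub_rev y y'] at hlip
    rw [hsq] at hgrowth
    have hA : A ≤ L ^ 2 * ‖y' - y‖ ^ 2 := by
      have := sq_nonneg ‖gradient (f x) y - gradient (f x) y'‖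
      linarith
    rw [hgx]
    calc b * A ≤ b * (L ^ 2 * ‖y' - y‖ ^ 2) := by gcongr
      _ = 2 * L ^ 2 * (b / 2 * ‖y' - y‖ ^ 2) := by ring
      _ ≤ 2 * L ^ 2 * (f x y' - f x y) := by
        gcongr
        linarith
  have hlim : μy * A ≤ 2 * L ^ 2 * (g x - f x y) := by
    have htends : Filter.Tendsto (fun b => b * A) (nhdsWithin μy (Set.Iio μy))
        (nhds (μy * A)) :=
      ((continuous_id.mul continuous_const).tendsto μy).mono_left nhdsWithin_le_nhds
    refine le_of_tendsto htends ?_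
    filter_upwards [Ioo_mem_nhdsLT hμy] with b hb using key b hb.1 hb.2
  rw [div_mul_eq_mul_div, le_div_iff₀ hμy]
  linarith
end
end

section
/- Let f : ℝ^{d_x} × ℝ^{d_y} → ℝ be L-smooth (L > 0) and satisfy the two-sided PL condition with constants μ_x, μ_y > 0. Let g(x) := sup_y f(x,y); assume this supremum is attained for every x. Assume g is differentiable and ∇g(x) = ∇_x f(x, ŷ) for every x and every maximizer ŷ of f(x, ·). Then for all x and y, ‖∇_x f(x,y) − ∇g(x)‖² ≤ (L²/μ_y²) ‖∇_y f(x,y)‖². -/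
noncomputable section

/-- If `φ` decreases at rate at most `C` away from `z`, its derivative at `z` has norm at
most `C`. -/
theorem HasFDerivAt.norm_le_of_eventually_sub_le {E : Type*} [NormedAddCommGroup E]
    [NormedSpace ℝ E] {φ : E → ℝ} {φ' : E →L[ℝ] ℝ} {z : E} {C : ℝ} (hC : 0 ≤ C)
    (hφ : HasFDerivAt φ φ' z) (h : ∀ᶠ w in nhds z, φ z - C * ‖w - z‖ ≤ φ w) : ‖φ'‖ ≤ C := by
  have key : ∀ v, -(C * ‖v‖) ≤ φ' v := by
    intro v
    have hline : HasDerivAt (fun t : ℝ => z + t • v) v 0 := by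
      simpa using ((hasDerivAt_id (0 : ℝ)).smul_const v).const_add z
    have hd : HasDerivAt (fun t : ℝ => φ (z + t • v)) (φ' v) 0 :=
      HasFDerivAt.comp_hasDerivAt (0 : ℝ) (by simpa using hφ) hline
    have hev : ∀ᶠ t in nhdsWithin (0 : ℝ) (Set.Ioi 0),
        φ z - C * ‖z + t • v - z‖ ≤ φ (z + t • v) :=
      Filter.Eventually.filter_mono nhdsWithin_le_nhds <|
        hline.continuousAt.eventually (p := fun w => φ z - C * ‖w - z‖ ≤ φ w)
          (by simpa only [zero_smul, add_zero] using h)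
    refine ge_of_tendsto hd.tendsto_slope_zero_right ?_
    filter_upwards [hev, self_mem_nhdsWithin] with t ht (htpos : 0 < t)
    rw [add_sub_cancel_left, norm_smul, Real.norm_of_nonneg htpos.le] at ht
    simp only [zero_add, zero_smul, add_zero, smul_eq_mul]
    rw [inv_mul_eq_div, le_div_iff₀ htpos]
    linarith
  refine φ'.opNorm_le_bound hC fun v => abs_le.2 ⟨key v, ?_⟩
  have := key (-v)
  rw [map_neg, norm_neg] at this
  linarith

/-- Quadratic growth of PL functions: a point whose value is less than `μ r² / 2` above the
infimum lies within distance `r` of a minimizer. -/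
theorem IsPL.exists_minimizer_dist_lt {d : ℕ} {h : EuclideanSpace ℝ (Fin d) → ℝ} {μ r : ℝ}
    (hh : IsPL h μ) (hμ : 0 < μ) (hr : 0 < r) {y : EuclideanSpace ℝ (Fin d)}
    (hy : h y - ⨅ w, h w < μ * r ^ 2 / 2) : ∃ z, ‖z - y‖ < r ∧ ∀ w, h z ≤ h w := by
  obtain ⟨hdiff, hbdd, hPL⟩ := hh
  set m := ⨅ w, h w
  have hm : ∀ w, m ≤ h w := ciInf_le hbdd
  set φ := fun w => √(h w - m)
  have hφcont : Continuous φ := (hdiff.continuous.sub continuous_const).sqrt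
  obtain ⟨C, hC₁, hC₂⟩ : ∃ C, φ y / r < C ∧ C < √(μ / 2) := by
    apply exists_between
    rw [div_lt_iff₀ hr, ← Real.sqrt_sq hr.le, ← Real.sqrt_mul (by positivity)]
    exact Real.sqrt_lt_sqrt (sub_nonneg.2 (hm y)) (by linarith)
  have hC : 0 < C := lt_of_le_of_lt (by positivity) hC₁
  rw [div_lt_iff₀ hr] at hC₁
  obtain ⟨z, -, hz⟩ := (isCompact_closedBall y r).exists_isMinOn
    (Metric.nonempty_closedBall.2 hr.le)
    (f := fun w => φ w + C * ‖w - y‖) (by fun_prop)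
  have hzr : ‖z - y‖ < r := by
    have h₁ : φ z + C * ‖z - y‖ ≤ φ y + C * ‖y - y‖ := hz (Metric.mem_closedBall_self hr.le)
    rw [sub_self, norm_zero] at h₁
    have h₂ : 0 ≤ φ z := Real.sqrt_nonneg _
    exact lt_of_mul_lt_mul_left (by linarith) hC.le
  refine ⟨z, hzr, ?_⟩
  by_contra! hne
  obtain ⟨w, hw⟩ := hne
  have hpos : 0 < h z - m := by linarith [hm w]
  have hφpos : 0 < φ z := Real.sqrt_pos.2 hpos
  have hderiv : HasFDerivAt φ ((1 / (2 * φ z)) • fderiv ℝ h z) z :=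
    ((hdiff z).hasFDerivAt.sub_const m).sqrt hpos.ne'
  have hle := hderiv.norm_le_of_eventually_sub_le hC.le <| by
    filter_upwards [Metric.isOpen_ball.mem_nhds (mem_ball_iff_norm.2 hzr)] with w hw
    have h₁ : φ z + C * ‖z - y‖ ≤ φ w + C * ‖w - y‖ := hz (Metric.ball_subset_closedBall hw)
    have h₂ : C * ‖w - y‖ ≤ C * (‖w - z‖ + ‖z - y‖) :=
      mul_le_mul_of_nonneg_left (norm_sub_le_norm_sub_add_norm_sub w z y) hC.le
    linarith
  have hnorm : ‖fderiv ℝ h z‖ = ‖gradient h z‖ := by simp [gradient]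
  rw [norm_smul, Real.norm_of_nonneg (by positivity), hnorm, one_div,
    inv_mul_le_iff₀ (by positivity)] at hle
  have hsq : φ z ^ 2 = h z - m := Real.sq_sqrt hpos.le
  have hC2 : C ^ 2 < μ / 2 := (Real.lt_sqrt hC.le).1 hC₂
  have h₁ : ‖gradient h z‖ ^ 2 ≤ (2 * φ z * C) ^ 2 := pow_le_pow_left₀ (norm_nonneg _) hle 2
  have h₂ := hPL z
  have h₃ : (h z - m) * C ^ 2 < (h z - m) * (μ / 2) := mul_lt_mul_of_pos_left hC2 hpos
  rw [mul_pow, mul_pow, hsq] at h₁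
  linarith

theorem stmt4 {dx dy : ℕ} (f : EuclideanSpace ℝ (Fin dx) → EuclideanSpace ℝ (Fin dy) → ℝ)
    (L μx μy : ℝ) (hL : 0 < L) (hμx : 0 < μx) (hμy : 0 < μy)
    (hsmooth : LSmooth f L)
    (hPL : TwoSidedPL f μx μy)
    (g : EuclideanSpace ℝ (Fin dx) → ℝ) (hg : ∀ x, g x = ⨆ y, f x y)
    (hatt : ∀ x, ∃ y, ∀ y', f x y' ≤ f x y)
    (hgdiff : Differentiable ℝ g)
    (hgrad : ∀ x y, (∀ y', f x y' ≤ f x y) →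
      gradient g x = gradient (fun x' => f x' y) x) :
    ∀ x y, ‖gradient (fun x' => f x' y) x - gradient g x‖ ^ 2 ≤
      L ^ 2 / μy ^ 2 * ‖gradient (f x) y‖ ^ 2 := by
  intro x y
  have hneg : ‖gradient (fun y => -f x y) y‖ = ‖gradient (f x) y‖ := by
    simp [gradient, fderiv_fun_neg]
  suffices h : ‖gradient (fun x' => f x' y) x - gradient g x‖ / L ≤ ‖gradient (f x) y‖ / μy by
    rw [div_le_iff₀ hL] at h
    calc _ ≤ (‖gradient (f x) y‖ / μy * L) ^ 2 := pow_le_pow_left₀ (norm_nonneg _) h 2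
      _ = _ := by ring
  refine le_of_forall_gt_imp_ge_of_dense fun r hr => ?_
  have hr0 : 0 < r := lt_of_le_of_lt (by positivity) hr
  rw [div_lt_iff₀ hμy] at hr
  have hgrowth : -f x y - ⨅ w, -f x w < μy * r ^ 2 / 2 := by
    have h₁ := (hPL.2 x).2.2 y
    rw [hneg] at h₁
    have h₂ : ‖gradient (f x) y‖ ^ 2 < (r * μy) ^ 2 :=
      pow_lt_pow_left₀ hr (norm_nonneg _) two_ne_zero
    refine lt_of_mul_lt_mul_left (a := 2 * μy) ?_ (by positivity)
    linarith
  obtain ⟨z, hzr, hz⟩ := (hPL.2 x).exists_minimizer_dist_lt hμy hr0 hgrowth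
  rw [hgrad x z fun w => neg_le_neg_iff.1 (hz w), div_le_iff₀ hL]
  have hlip := hsmooth.2 x x y z
  rw [sub_self, norm_zero, norm_sub_rev y z] at hlip
  have h₁ : ‖z - y‖ ^ 2 ≤ r ^ 2 := pow_le_pow_left₀ (norm_nonneg _) hzr.le 2
  have h₂ : L ^ 2 * ‖z - y‖ ^ 2 ≤ L ^ 2 * r ^ 2 := mul_le_mul_of_nonneg_left h₁ (sq_nonneg L)
  refine (sq_le_sq₀ (norm_nonneg _) (by positivity)).1 ?_
  linarith [sq_nonneg ‖gradient (f x) y - gradient (f x) z‖]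
end
end

section
/- Let f : ℝ^{d_x} × ℝ^{d_y} → ℝ be L-smooth (L > 0) and suppose −f(x, ·) is μ_y-PL for every x with 0 < μ_y ≤ L. Let g(x) := sup_y f(x,y); assume this supremum is attained for every x. Assume g is differentiable and ∇g(x) = ∇_x f(x, ŷ) for every x and every maximizer ŷ of f(x, ·). Then ∇g is Lipschitz with constant L + L²/μ_y, i.e. ‖∇g(x) − ∇g(x')‖ ≤ (L + L²/μ_y) ‖x − x'‖ for all x, x'; in particular, since L/μ_y ≥ 1, ∇g is Lipschitz with constant 2L²/μ_y. -/
noncomputable section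

/-- A PL function which attains its infimum satisfies an error bound: the distance from `z` to the
set of minimizers is at most `‖∇h z‖ / ν` for every `ν < μ`. -/
theorem IsPL.exists_minimizer_near {d : ℕ} {h : EuclideanSpace ℝ (Fin d) → ℝ} {μ ν : ℝ}
    (hPL : IsPL h μ) (hatt : ∃ m, ∀ y, h m ≤ h y) (hν : 0 < ν) (hνμ : ν < μ)
    (z : EuclideanSpace ℝ (Fin d)) :
    ∃ w, (∀ y, h w ≤ h y) ∧ ν * ‖w - z‖ ≤ ‖gradient h z‖ := by
  obtain ⟨hdiff, -, hgrad⟩ := hPL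
  obtain ⟨m, hm⟩ := hatt
  have hinf : ⨅ y, h y = h m :=
    (show IsLeast (Set.range h) (h m) from ⟨⟨m, rfl⟩, by rintro _ ⟨y, rfl⟩; exact hm y⟩).csInf_eq
  rw [hinf] at hgrad
  have hμ : 0 < μ := hν.trans hνμ
  have hs : 0 < √(2 * μ) := by positivity
  have hs2 : √(2 * μ) ^ 2 = 2 * μ := Real.sq_sqrt (by positivity)
  -- minimize the square root of the gap penalized by the distance to `z`
  obtain ⟨w, hw⟩ : ∃ w, ∀ y, √(h w - h m) + ν / √(2 * μ) * dist w z ≤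
      √(h y - h m) + ν / √(2 * μ) * dist y z := by
    refine Continuous.exists_forall_le (by have := hdiff.continuous; fun_prop) ?_
    refine Filter.tendsto_atTop_mono (f := fun y => ν / √(2 * μ) * dist y z)
      (fun y => le_add_of_nonneg_left (Real.sqrt_nonneg _)) ?_
    exact (tendsto_dist_right_cocompact_atTop z).const_mul_atTop (by positivity)
  have hwm : h w = h m := by
    by_contra hne
    have hgap : 0 < h w - h m := sub_pos.2 (lt_of_le_of_ne (hm w) (Ne.symm hne))
    set G := gradient h w with hG
    set u := √(h w - h m) with hu
    have hu0 : 0 < u := Real.sqrt_pos.2 hgap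
    have hu2 : u ^ 2 = h w - h m := Real.sq_sqrt hgap.le
    have hpl : 2 * μ * u ^ 2 ≤ ‖G‖ ^ 2 := hu2 ▸ hgrad w
    have hG0 : 0 < ‖G‖ := by
      have : 0 < 2 * μ * u ^ 2 := by positivity
      exact (norm_nonneg G).lt_of_ne fun h0 => by rw [← h0] at hpl; linarith
    have hline : HasDerivAt (fun t : ℝ => w - t • G) (-G) 0 := by
      simpa using ((hasDerivAt_id (0 : ℝ)).smul_const G).const_sub w
    have hcomp : HasDerivAt (fun t : ℝ => h (w - t • G)) (-‖G‖ ^ 2) 0 := by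
      have h1 : HasFDerivAt h (InnerProductSpace.toDual ℝ _ G) (w - (0 : ℝ) • G) := by
        rw [zero_smul, sub_zero]
        exact (hdiff w).hasGradientAt.hasFDerivAt
      have h2 := h1.comp_hasDerivAt (0 : ℝ) hline
      rwa [InnerProductSpace.toDual_apply_apply, inner_neg_right,
        real_inner_self_eq_norm_sq] at h2
    have hphi : HasDerivAt (fun t : ℝ => √(h (w - t • G) - h m) + ν / √(2 * μ) * (t * ‖G‖))
        (-‖G‖ ^ 2 / (2 * u) + ν / √(2 * μ) * ‖G‖) 0 := by
      have h1 := (hcomp.sub_const (h m)).sqrt (by simpa using hgap.ne')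
      have h2 := (((hasDerivAt_id (0 : ℝ)).mul_const ‖G‖).const_mul (ν / √(2 * μ)))
      have h3 := h1.add h2
      rwa [zero_smul, sub_zero, one_mul] at h3
    have hmin : IsLocalMinOn (fun t : ℝ => √(h (w - t • G) - h m) + ν / √(2 * μ) * (t * ‖G‖))
        (Set.Ici 0) 0 := by
      refine IsMinOn.localize fun t ht => ?_
      have ht : 0 ≤ t := ht
      have h1 := hw (w - t • G)
      have h2 : dist (w - t • G) z ≤ t * ‖G‖ + dist w z := by
        refine (dist_triangle _ w _).trans (add_le_add_left (le_of_eq ?_) _)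
        simp [norm_smul, abs_of_nonneg ht]
      have h3 := mul_le_mul_of_nonneg_left h2 (by positivity : 0 ≤ ν / √(2 * μ))
      simp only [Set.mem_ofPred_eq, zero_smul, sub_zero, zero_mul, mul_zero, add_zero]
      linarith
    have hnonneg : 0 ≤ -‖G‖ ^ 2 / (2 * u) + ν / √(2 * μ) * ‖G‖ := by
      have := hmin.hasFDerivWithinAt_nonneg hphi.hasFDerivAt.hasFDerivWithinAt (y := 1)
        (mem_posTangentConeAt_of_segment_subset (by
          rw [zero_add, segment_eq_Icc zero_le_one]; exact Set.Icc_subset_Ici_self))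
      simpa using this
    have h1 : ‖G‖ * √(2 * μ) ≤ 2 * ν * u := by
      have h2 : -‖G‖ ^ 2 / (2 * u) + ν / √(2 * μ) * ‖G‖ =
          ‖G‖ / (2 * u * √(2 * μ)) * (2 * ν * u - ‖G‖ * √(2 * μ)) := by field_simp; ring
      rw [h2] at hnonneg
      exact sub_nonneg.1 (nonneg_of_mul_nonneg_right hnonneg (by positivity))
    have h2 : √(2 * μ) * u ≤ ‖G‖ :=
      le_of_sq_le_sq (by rw [mul_pow, hs2]; exact hpl) hG0.le
    have h3 : √(2 * μ) * u * √(2 * μ) ≤ 2 * ν * u :=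
      (mul_le_mul_of_nonneg_right h2 hs.le).trans h1
    have h4 : 2 * μ * u ≤ 2 * ν * u := by nlinarith
    nlinarith
  refine ⟨w, fun y => hwm ▸ hm y, ?_⟩
  have h1 := hw z
  rw [hwm, sub_self, Real.sqrt_zero, zero_add, dist_self, mul_zero, add_zero, dist_eq_norm,
    div_mul_eq_mul_div, div_le_iff₀ hs] at h1
  refine h1.trans (abs_le_of_sq_le_sq' ?_ (norm_nonneg _)).2
  rw [mul_pow, hs2, Real.sq_sqrt (sub_nonneg.2 (hm z)), mul_comm]
  exact hgrad z

theorem stmt5 {dx dy : ℕ} (f : EuclideanSpace ℝ (Fin dx) → EuclideanSpace ℝ (Fin dy) → ℝ)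
    (L μy : ℝ) (hL : 0 < L) (hμy : 0 < μy) (hμyL : μy ≤ L)
    (hsmooth : LSmooth f L)
    (hPLy : ∀ x, IsPL (fun y => -f x y) μy)
    (g : EuclideanSpace ℝ (Fin dx) → ℝ) (hg : ∀ x, g x = ⨆ y, f x y)
    (hatt : ∀ x, ∃ y, ∀ y', f x y' ≤ f x y)
    (hgdiff : Differentiable ℝ g)
    (hgrad : ∀ x y, (∀ y', f x y' ≤ f x y) →
      gradient g x = gradient (fun x' => f x' y) x) :
    ∀ x x', ‖gradient g x - gradient g x'‖ ≤ (L + L ^ 2 / μy) * ‖x - x'‖ ∧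
      ‖gradient g x - gradient g x'‖ ≤ 2 * L ^ 2 / μy * ‖x - x'‖ := by
  have hbound : ∀ x x', ‖gradient g x - gradient g x'‖ ≤ (L + L ^ 2 / μy) * ‖x - x'‖ := by
    intro x x'
    obtain ⟨y, hy⟩ := hatt x'
    have hy0 : gradient (f x') y = 0 := by
      have : IsLocalMax (f x') y := Filter.Eventually.of_forall hy
      simp [gradient, this.fderiv_eq_zero]
    have hgy : ‖gradient (fun y => -f x y) y‖ ≤ L * ‖x - x'‖ := by
      have h1 := hsmooth.2 x x' y y
      have h2 : gradient (fun y => -f x y) y = -gradient (f x) y := by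
        simp [gradient, fderiv_fun_neg]
      rw [h2, norm_neg]
      refine (abs_le_of_sq_le_sq' ?_ (by positivity)).2
      rw [hy0, sub_zero, sub_self, norm_zero] at h1
      nlinarith [sq_nonneg ‖gradient (fun x'' => f x'' y) x - gradient (fun x'' => f x'' y) x'‖]
    have key : ∀ ν ∈ Set.Ioo 0 μy,
        ‖gradient g x - gradient g x'‖ ≤ (L + L ^ 2 / ν) * ‖x - x'‖ := by
      rintro ν ⟨hν, hνμ⟩
      obtain ⟨w, hw, hwy⟩ := (hPLy x).exists_minimizer_near
        ((hatt x).imp fun m hm y => neg_le_neg (hm y)) hν hνμ y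
      have hdist : ‖w - y‖ ≤ L / ν * ‖x - x'‖ := by
        rw [div_mul_eq_mul_div, le_div_iff₀ hν, mul_comm]
        exact hwy.trans hgy
      rw [hgrad x w fun y => neg_le_neg_iff.1 (hw y), hgrad x' y hy]
      have h1 := hsmooth.2 x x' w y
      have h2 : ‖gradient (fun x'' => f x'' w) x - gradient (fun x'' => f x'' y) x'‖ ≤
          L * (‖x - x'‖ + ‖w - y‖) := by
        refine (abs_le_of_sq_le_sq' ?_ (by positivity)).2
        have : 0 ≤ L ^ 2 * (2 * ‖x - x'‖ * ‖w - y‖) := by positivity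
        nlinarith [sq_nonneg ‖gradient (f x) w - gradient (f x') y‖]
      calc _ ≤ L * (‖x - x'‖ + ‖w - y‖) := h2
        _ ≤ L * (‖x - x'‖ + L / ν * ‖x - x'‖) := by gcongr
        _ = _ := by ring
    have hlim : Filter.Tendsto (fun ν => (L + L ^ 2 / ν) * ‖x - x'‖) (nhdsWithin μy (Set.Iio μy))
        (nhds ((L + L ^ 2 / μy) * ‖x - x'‖)) := by
      refine Filter.Tendsto.mono_left (ContinuousAt.tendsto ?_) nhdsWithin_le_nhds
      have := hμy.ne'
      fun_prop (disch := assumption)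
    exact ge_of_tendsto hlim (Filter.mem_of_superset (Ioo_mem_nhdsLT hμy) key)
  intro x x'
  refine ⟨hbound x x', (hbound x x').trans (mul_le_mul_of_nonneg_right ?_ (norm_nonneg _))⟩
  rw [le_div_iff₀ hμy, add_mul, div_mul_cancel₀ _ hμy.ne']
  nlinarith
end
end

section
/- Let f : ℝ^{d_x} × ℝ^{d_y} → ℝ be L-smooth (L > 0) and satisfy the two-sided PL condition with constants μ_x, μ_y > 0, and assume the supremum sup_y f(x,y) is attained for every x. Let (x*, y*) be a saddle point of f. Then for every x, dist(y*, argmax_y f(x,y))² ≤ (L²/μ_y²) ‖x − x*‖², where dist denotes the Euclidean distance from a point to a set. -/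
open InnerProductSpace in
theorem HasGradientAt.norm_le_of_sub_mul_norm_le {E : Type*} [NormedAddCommGroup E]
    [InnerProductSpace ℝ E] [CompleteSpace E] {φ : E → ℝ} {G w : E} {c : ℝ}
    (hφ : HasGradientAt φ G w) (hc : 0 ≤ c) (h : ∀ w', φ w - c * ‖w' - w‖ ≤ φ w') :
    ‖G‖ ≤ c := by
  have hline : HasDerivAt (fun t : ℝ => w + t • (-G)) (-G) 0 := by
    simpa using ((hasDerivAt_id (0 : ℝ)).smul_const (-G)).const_add w
  have hφ' : HasFDerivAt φ (toDual ℝ E G) (w + (0 : ℝ) • (-G)) := by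
    simpa using hφ.hasFDerivAt
  have hcomp := hφ'.comp_hasDerivAt (0 : ℝ) hline
  have hsum := hcomp.add ((hasDerivAt_id (0 : ℝ)).mul_const (c * ‖G‖))
  have hmin : IsMinOn ((φ ∘ fun t : ℝ => w + t • (-G)) + fun t : ℝ => id t * (c * ‖G‖))
      (Set.Icc 0 1) 0 := by
    intro t ht
    have := h (w + t • (-G))
    rw [add_sub_cancel_left, norm_smul, norm_neg, Real.norm_of_nonneg ht.1] at this
    simp only [Set.mem_ofPred_eq, Pi.add_apply, Function.comp_apply, id, zero_smul, add_zero,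
      zero_mul]
    linarith
  have hnonneg := hmin.localize.hasFDerivWithinAt_nonneg
    hsum.hasFDerivAt.hasFDerivWithinAt
    (mem_posTangentConeAt_of_segment_subset (y := 1) (by simp [segment_eq_Icc]))
  simp only [ContinuousLinearMap.toSpanSingleton_apply, smul_eq_mul, one_mul, map_neg,
    toDual_apply_apply, real_inner_self_eq_norm_sq] at hnonneg
  by_contra! hlt
  nlinarith [norm_nonneg G]

/-- A Łojasiewicz inequality with exponent `1 / 2` implies quadratic growth. -/
theorem sq_mul_infDist_sq_le_of_pl {E : Type*} [NormedAddCommGroup E] [InnerProductSpace ℝ E]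
    [FiniteDimensional ℝ E] {h : E → ℝ} {m μ : ℝ} (hμ : 0 < μ) (hd : Differentiable ℝ h)
    (hm : ∀ w, m ≤ h w) (hPL : ∀ w, 2 * μ * (h w - m) ≤ ‖gradient h w‖ ^ 2) (z : E) :
    μ / 2 * Metric.infDist z {w | h w = m} ^ 2 ≤ h z - m := by
  have key : ∀ c : ℝ, 0 < c → c < √(μ / 2) →
      c * Metric.infDist z {w | h w = m} ≤ √(h z - m) := by
    intro c hc hcμ
    have hcont : Continuous fun w => √(h w - m) + c * ‖w - z‖ := by
      have := hd.continuous
      fun_prop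
    have hcoer : Filter.Tendsto (fun w => √(h w - m) + c * ‖w - z‖)
        (Filter.cocompact E) Filter.atTop := by
      refine Filter.tendsto_atTop_mono (f := fun w => c * ‖w - z‖)
        (fun w => le_add_of_nonneg_left (Real.sqrt_nonneg _)) ?_
      refine Filter.Tendsto.const_mul_atTop hc ?_
      simpa only [dist_eq_norm] using tendsto_dist_right_cocompact_atTop z
    obtain ⟨w, hw⟩ := hcont.exists_forall_le hcoer
    have hwm : h w = m := by
      by_contra hne
      have hpos : 0 < h w - m := sub_pos.2 (lt_of_le_of_ne (hm w) (Ne.symm hne))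
      have hsqrt : 0 < √(h w - m) := Real.sqrt_pos.2 hpos
      have hgrad : HasGradientAt (fun w => √(h w - m))
          ((1 / (2 * √(h w - m))) • gradient h w) w := by
        rw [hasGradientAt_iff_hasFDerivAt, map_smul]
        exact ((hd w).hasGradientAt.hasFDerivAt.sub_const m).sqrt hpos.ne'
      have hle := hgrad.norm_le_of_sub_mul_norm_le hc.le fun w' => by
        have := hw w'
        have htri : ‖w' - z‖ ≤ ‖w' - w‖ + ‖w - z‖ := norm_sub_le_norm_sub_add_norm_sub w' w z
        nlinarith
      rw [norm_smul, Real.norm_of_nonneg (by positivity), one_div_mul_eq_div,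
        div_le_iff₀ (by positivity)] at hle
      have hsq := pow_le_pow_left₀ (norm_nonneg _) hle 2
      have hcsq : c ^ 2 < μ / 2 := (Real.lt_sqrt hc.le).1 hcμ
      have := hPL w
      rw [mul_pow, mul_pow, Real.sq_sqrt hpos.le] at hsq
      nlinarith
    have hz := hw z
    have hdist : Metric.infDist z {w | h w = m} ≤ ‖w - z‖ := by
      rw [← dist_eq_norm, dist_comm]
      exact Metric.infDist_le_dist_of_mem hwm
    simp only [hwm, sub_self, Real.sqrt_zero, zero_add, norm_zero, mul_zero, add_zero] at hz
    exact (mul_le_mul_of_nonneg_left hdist hc.le).trans hz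
  have hlim : √(μ / 2) * Metric.infDist z {w | h w = m} ≤ √(h z - m) := by
    have htend : Filter.Tendsto (fun c : ℝ => c * Metric.infDist z {w | h w = m})
        (nhdsWithin √(μ / 2) (Set.Iio √(μ / 2)))
        (nhds (√(μ / 2) * Metric.infDist z {w | h w = m})) :=
      ((continuous_id.mul continuous_const).tendsto _).mono_left nhdsWithin_le_nhds
    refine le_of_tendsto htend ?_
    filter_upwards [Ioo_mem_nhdsLT (Real.sqrt_pos.2 (half_pos hμ))] with c hc
    exact key c hc.1 hc.2
  have hsq := pow_le_pow_left₀ (mul_nonneg (Real.sqrt_nonneg _) Metric.infDist_nonneg) hlim 2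
  rwa [mul_pow, Real.sq_sqrt (half_pos hμ).le, Real.sq_sqrt (sub_nonneg.2 (hm z))] at hsq


noncomputable section

theorem stmt6 {dx dy : ℕ} (f : EuclideanSpace ℝ (Fin dx) → EuclideanSpace ℝ (Fin dy) → ℝ)
    (L μx μy : ℝ) (hL : 0 < L) (hμx : 0 < μx) (hμy : 0 < μy)
    (hsmooth : LSmooth f L)
    (hPL : TwoSidedPL f μx μy)
    (hatt : ∀ x, ∃ y, ∀ y', f x y' ≤ f x y)
    (xs : EuclideanSpace ℝ (Fin dx)) (ys : EuclideanSpace ℝ (Fin dy)) (hsaddle : IsSaddle f (xs, ys)) :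
    ∀ x, Metric.infDist ys {y | ∀ y', f x y' ≤ f x y} ^ 2 ≤
      L ^ 2 / μy ^ 2 * ‖x - xs‖ ^ 2 := by
  intro x
  obtain ⟨yx, hyx⟩ := hatt x
  obtain ⟨hd, hbdd, hpl⟩ := hPL.2 x
  have hinf : ⨅ y, -f x y = -f x yx :=
    le_antisymm (ciInf_le hbdd yx) (le_ciInf fun y => neg_le_neg (hyx y))
  have hset : {y | ∀ y', f x y' ≤ f x y} = {y | -f x y = -f x yx} := by
    ext y
    simp only [Set.mem_ofPred_eq, neg_inj]
    exact ⟨fun hy => le_antisymm (hyx y) (hy yx), fun hy y' => hy ▸ hyx y'⟩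
  simp only [hinf] at hpl
  have hgrowth := sq_mul_infDist_sq_le_of_pl hμy hd (fun y => neg_le_neg (hyx y)) hpl ys
  have hneg : ‖gradient (fun y => -f x y) ys‖ = ‖gradient (f x) ys‖ := by
    simp [gradient, fderiv_fun_neg]
  have hzero : gradient (f xs) ys = 0 := by
    have hmax : IsLocalMax (f xs) ys := Filter.Eventually.of_forall fun y => (hsaddle xs y).1
    simp [gradient, hmax.fderiv_eq_zero]
  have hlip := hsmooth.2 x xs ys ys
  rw [hzero, sub_zero, sub_self, norm_zero] at hlip
  have hplys := hpl ys
  rw [hneg] at hplys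
  rw [hset, div_mul_eq_mul_div, le_div_iff₀ (by positivity)]
  nlinarith [sq_nonneg ‖gradient (fun x'' => f x'' ys) x - gradient (fun x'' => f x'' ys) xs‖]
end
end

section
/- Let f : ℝ^{d_x} × ℝ^{d_y} → ℝ be L-smooth (L > 0) and satisfy the two-sided PL condition with constants μ_x, μ_y > 0 where μ_x ≤ L and μ_y ≤ L. Let g(x) := sup_y f(x,y); assume this supremum is attained for every x and g* := inf_x g(x) is finite. Assume g is differentiable and ∇g(x) = ∇_x f(x, ŷ) for every x and every maximizer ŷ of f(x, ·). Set τ_y = 1/L, λ = 6L²/μ_y², τ_x = τ_y/(22λ), and define the simultaneous GDA iterates x_{k+1} = x_k − τ_x ∇_x f(x_k, y_k), y_{k+1} = y_k + τ_y ∇_y f(x_k, y_k), and the Lyapunov value V_0 = (g(x_0) − g*) + (λτ_x/τ_y)(g(x_0) − f(x_0, y_0)). Then there exists a saddle point (x*, y*) of f such that for all k ≥ 0, ‖x_k − x*‖² + ‖y_k − y*‖² ≤ (2 c^k / (1 − √c)²) · max{4/μ_x, 88/μ_y} · V_0, where c = 1 − μ_x τ_x / 2. -/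
noncomputable section

section PolyakLojasiewicz

open Filter Topology

theorem image_le_add_inner_gradient {E : Type*} [NormedAddCommGroup E] [InnerProductSpace ℝ E]
    [CompleteSpace E] {h : E → ℝ} {K : ℝ} (hd : Differentiable ℝ h)
    (hK : ∀ z w, ‖gradient h z - gradient h w‖ ≤ K * ‖z - w‖) (z u : E) :
    h (z + u) ≤ h z + inner ℝ (gradient h z) u + K / 2 * ‖u‖ ^ 2 := by
  have hder (t : ℝ) : HasDerivAt
      (fun t : ℝ => h (z + t • u) - t * inner ℝ (gradient h z) u - K / 2 * t ^ 2 * ‖u‖ ^ 2)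
      (inner ℝ (gradient h (z + t • u) - gradient h z) u - K * t * ‖u‖ ^ 2) t := by
    have h1 : HasDerivAt (fun t : ℝ => z + t • u) u t := by
      simpa using ((hasDerivAt_id t).smul_const u).const_add z
    have h2 := ((hd (z + t • u)).hasGradientAt.hasFDerivAt).comp_hasDerivAt t h1
    have h3 := (hasDerivAt_id t).mul_const (inner ℝ (gradient h z) u)
    have h4 := (((hasDerivAt_id t).pow 2).const_mul (K / 2)).mul_const (‖u‖ ^ 2)
    refine ((h2.sub h3).sub h4).congr_deriv ?_
    simp only [InnerProductSpace.toDual_apply_apply, inner_sub_left, id]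
    push_cast
    ring
  have hanti := antitoneOn_of_deriv_nonpos (convex_Icc (0 : ℝ) 1)
    (fun t _ => (hder t).continuousAt.continuousWithinAt)
    (fun t _ => (hder t).differentiableAt.differentiableWithinAt) (by
      intro t ht
      rw [interior_Icc] at ht
      rw [(hder t).deriv]
      have h1 := real_inner_le_norm (gradient h (z + t • u) - gradient h z) u
      have h2 := hK (z + t • u) z
      rw [add_sub_cancel_left, norm_smul, Real.norm_of_nonneg ht.1.le] at h2
      nlinarith [mul_le_mul_of_nonneg_right h2 (norm_nonneg u)])
  have := hanti (Set.left_mem_Icc.2 zero_le_one) (Set.right_mem_Icc.2 zero_le_one) zero_le_one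
  simp only [one_smul, zero_smul, add_zero] at this
  linarith

theorem sq_norm_gradient_le {E : Type*} [NormedAddCommGroup E] [InnerProductSpace ℝ E]
    [CompleteSpace E] {h : E → ℝ} {K m : ℝ} (hK0 : 0 < K) (hd : Differentiable ℝ h)
    (hK : ∀ z w, ‖gradient h z - gradient h w‖ ≤ K * ‖z - w‖) (hm : ∀ z, m ≤ h z) (z : E) :
    ‖gradient h z‖ ^ 2 ≤ 2 * K * (h z - m) := by
  have h1 := image_le_add_inner_gradient hd hK z (-(1 / K) • gradient h z)
  have h2 := hm (z + -(1 / K) • gradient h z)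
  rw [inner_smul_right, real_inner_self_eq_norm_sq, norm_smul, mul_pow, Real.norm_eq_abs,
    sq_abs] at h1
  have h3 : K / 2 * ((-(1 / K)) ^ 2 * ‖gradient h z‖ ^ 2) = 1 / K * ‖gradient h z‖ ^ 2 / 2 := by
    field_simp
  have h4 : ‖gradient h z‖ ^ 2 = K * (1 / K * ‖gradient h z‖ ^ 2) := by field_simp
  rw [h4]
  nlinarith

/-- Quadratic growth of a PL function on a finite-dimensional space. -/
theorem exists_eq_min_of_PL {E : Type*} [NormedAddCommGroup E] [InnerProductSpace ℝ E]
    [FiniteDimensional ℝ E] {h : E → ℝ} {μ m : ℝ} (hμ : 0 < μ) (hd : Differentiable ℝ h)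
    (hm : ∀ z, m ≤ h z) (hPL : ∀ z, 2 * μ * (h z - m) ≤ ‖gradient h z‖ ^ 2) (z : E) :
    ∃ w, h w = m ∧ ‖z - w‖ ^ 2 ≤ 4 / μ * (h z - m) := by
  have hc : 0 < √μ / 2 := by positivity
  have hcont : Continuous fun w => √(h w - m) + √μ / 2 * ‖w - z‖ := by
    have := hd.continuous
    fun_prop
  have hlim : Tendsto (fun w => √(h w - m) + √μ / 2 * ‖w - z‖) (cocompact E) atTop := by
    refine tendsto_atTop_mono (f := fun w => √μ / 2 * (‖w‖ - ‖z‖)) (fun w => ?_) ?_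
    · nlinarith [Real.sqrt_nonneg (h w - m), norm_sub_norm_le w z]
    · exact (tendsto_atTop_add_const_right _ _ (tendsto_norm_cocompact_atTop)).const_mul_atTop hc
  obtain ⟨w, hw⟩ := hcont.exists_forall_le hlim
  have hwm : h w = m := by
    by_contra hne
    have hpos : 0 < h w - m := sub_pos.2 (lt_of_le_of_ne (hm w) (Ne.symm hne))
    set D := gradient h w with hD
    have hs := Real.sqrt_pos.2 hpos
    have hDs : √μ * √(h w - m) < ‖D‖ := by
      rw [← Real.sqrt_mul hμ.le]
      refine Real.sqrt_lt' ?_ |>.2 ?_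
      · by_contra hD0
        have : ‖D‖ = 0 := le_antisymm (not_lt.1 hD0) (norm_nonneg _)
        have hw' := hPL w
        rw [← hD, this] at hw'
        nlinarith [mul_pos hμ hpos]
      · nlinarith [hPL w, mul_pos hμ hpos]
    have hDpos : 0 < ‖D‖ := lt_of_le_of_lt (by positivity) hDs
    have hder : HasDerivAt (fun t : ℝ => √(h (w + t • (-D)) - m) + √μ / 2 * (t * ‖D‖))
        (-‖D‖ ^ 2 / (2 * √(h w - m)) + √μ / 2 * ‖D‖) 0 := by
      have h1 : HasDerivAt (fun t : ℝ => w + t • (-D)) (-D) 0 := by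
        simpa using ((hasDerivAt_id (0 : ℝ)).smul_const (-D)).const_add w
      have h2 := ((hd (w + (0 : ℝ) • (-D))).hasGradientAt.hasFDerivAt).comp_hasDerivAt 0 h1
      have h3 := (h2.sub_const m).sqrt (by simpa using hpos.ne')
      have h4 := ((hasDerivAt_id (0 : ℝ)).mul_const ‖D‖).const_mul (√μ / 2)
      refine (h3.add h4).congr_deriv ?_
      simp [← hD]
    have hneg : -‖D‖ ^ 2 / (2 * √(h w - m)) + √μ / 2 * ‖D‖ < 0 := by
      rw [div_add' _ _ _ (by positivity)]
      apply div_neg_of_neg_of_pos _ (by positivity)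
      nlinarith
    have hslope := (hasDerivAt_iff_tendsto_slope.1 hder).eventually_lt_const hneg
    have hslope' := hslope.filter_mono (nhdsWithin_mono (0 : ℝ) (s := Set.Ioi 0)
      (fun t ht => ne_of_gt ht))
    obtain ⟨t, ht, ht0⟩ := (hslope'.and self_mem_nhdsWithin).exists
    have ht0 : 0 < t := ht0
    rw [slope_def_field, sub_zero, div_lt_iff₀ ht0] at ht
    simp only [zero_smul, add_zero, zero_mul, mul_zero] at ht
    have h5 := hw (w + t • (-D))
    have h6 : ‖w + t • (-D) - z‖ ≤ ‖w - z‖ + t * ‖D‖ := by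
      calc ‖w + t • (-D) - z‖ = ‖(w - z) + t • (-D)‖ := by congr 1; abel
        _ ≤ _ := (norm_add_le _ _).trans (by
          rw [norm_smul, norm_neg, Real.norm_of_nonneg ht0.le])
    nlinarith [mul_le_mul_of_nonneg_left h6 hc.le]
  refine ⟨w, hwm, ?_⟩
  have h1 := hw z
  simp only [hwm, sub_self, Real.sqrt_zero, norm_zero, mul_zero, zero_add, add_zero] at h1
  have h2 := pow_le_pow_left₀ (by positivity) h1 2
  rw [mul_pow, div_pow, Real.sq_sqrt hμ.le, Real.sq_sqrt (sub_nonneg.2 (hm z)),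
    norm_sub_rev] at h2
  rw [div_mul_eq_mul_div, le_div_iff₀ hμ]
  linarith

theorem exists_limit_of_sq_norm_sub_le_geometric {E : Type*} [NormedAddCommGroup E]
    [CompleteSpace E] {u : ℕ → E} {A c : ℝ} (hA : 0 ≤ A) (hc0 : 0 ≤ c) (hc1 : c < 1)
    (hu : ∀ k, ‖u (k + 1) - u k‖ ^ 2 ≤ A * c ^ k) :
    ∃ l, Tendsto u atTop (𝓝 l) ∧ ∀ k, ‖u k - l‖ ^ 2 ≤ A * c ^ k / (1 - √c) ^ 2 := by
  have hr : √c < 1 := by rw [Real.sqrt_lt' one_pos]; simpa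
  have hsq (k : ℕ) : (√A * √c ^ k) ^ 2 = A * c ^ k := by
    rw [mul_pow, Real.sq_sqrt hA, ← pow_mul, mul_comm k 2, pow_mul, Real.sq_sqrt hc0]
  have hdist : ∀ k, dist (u k) (u (k + 1)) ≤ √A * √c ^ k := fun k => by
    rw [dist_comm, dist_eq_norm]
    exact abs_le_of_sq_le_sq' ((hu k).trans (hsq k).ge) (by positivity) |>.2
  obtain ⟨l, hl⟩ := cauchySeq_tendsto_of_complete (cauchySeq_of_le_geometric _ _ hr hdist)
  refine ⟨l, hl, fun k => ?_⟩
  have h1 := dist_le_of_le_geometric_of_tendsto _ _ hr hdist hl k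
  rw [dist_eq_norm] at h1
  have h2 := pow_le_pow_left₀ (norm_nonneg _) h1 2
  rwa [div_pow, hsq] at h2

theorem gradient_fun_neg {E : Type*} [NormedAddCommGroup E] [InnerProductSpace ℝ E]
    [CompleteSpace E] (h : E → ℝ) (z : E) :
    gradient (fun z => -h z) z = -gradient h z := by
  simp [gradient, fderiv_fun_neg]

theorem gradient_eq_zero_of_forall_le {E : Type*} [NormedAddCommGroup E] [InnerProductSpace ℝ E]
    [CompleteSpace E] {h : E → ℝ} {z : E} (hz : ∀ w, h z ≤ h w) : gradient h z = 0 := by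
  simp [gradient, IsLocalMin.fderiv_eq_zero (Eventually.of_forall hz)]

theorem lyapunov_scalar_contraction {L μx μy T a b g' f₀ f₁ f₂ P Q G I J : ℝ} (hL : 0 < L)
    (hμx : 0 < μx) (hμy : 0 < μy) (hμxL : μx ≤ L) (hμyL : μy ≤ L)
    (hT : T = μy ^ 2 / (132 * L ^ 3)) (ha0 : 0 ≤ a) (hb0 : 0 ≤ b) (hb : b = a - f₀)
    (e1 : g' ≤ a + -(T * I) + 2 * L ^ 2 / μy / 2 * (T * P) ^ 2)
    (e2 : -f₁ ≤ -f₀ + T * P ^ 2 + L / 2 * (T * P) ^ 2)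
    (e3 : -f₂ ≤ -f₁ + -(1 / L * J) + L / 2 * (1 / L * Q) ^ 2)
    (e5 : G ^ 2 - 2 * I + P ^ 2 ≤ L ^ 2 * (4 / μy * b))
    (e6 : 2 * μx * a ≤ G ^ 2) (e7 : 2 * μy * b ≤ Q ^ 2) (e8 : Q ^ 2 - T * L * (P * Q) ≤ J) :
    g' + 1 / 22 * (g' - f₂) ≤ (1 - μx * T / 2) * (a + 1 / 22 * b) := by
  have hT0 : 0 < T := by rw [hT]; positivity
  have hr : μy / L ≤ 1 := (div_le_one hL).2 hμyL
  have hr0 : 0 < μy / L := by positivity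
  have hTL : T * L = (μy / L) ^ 2 / 132 := by rw [hT]; field_simp
  have hTL' : T * L ≤ μy / L / 132 := by rw [hTL]; nlinarith
  have hTL1 : T * L ≤ 1 / 132 := by linarith
  have hW : 0 ≤ T * P ^ 2 := by positivity
  have hS : 0 ≤ Q ^ 2 / L := by positivity
  have i1 : 2 * L ^ 2 / μy / 2 * (T * P) ^ 2 ≤ 1 / 132 * (T * P ^ 2) := by
    have : 2 * L ^ 2 / μy / 2 * (T * P) ^ 2 = μy / L / 132 * (T * P ^ 2) := by
      rw [hT]; field_simp
    rw [this]
    exact mul_le_mul_of_nonneg_right (by linarith) hW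
  have i2 : L / 2 * (T * P) ^ 2 ≤ 1 / 264 * (T * P ^ 2) := by
    have : L / 2 * (T * P) ^ 2 = T * L / 2 * (T * P ^ 2) := by ring
    rw [this]
    exact mul_le_mul_of_nonneg_right (by linarith) hW
  have i3 : T * G ^ 2 - 2 * (T * I) + T * P ^ 2 ≤ μy / L * b / 33 := by
    have : T * (L ^ 2 * (4 / μy * b)) = μy / L * b / 33 := by rw [hT]; field_simp; ring
    rw [← this]
    linarith [mul_le_mul_of_nonneg_left e5 hT0.le]
  have i4 : L / 2 * (1 / L * Q) ^ 2 = Q ^ 2 / L / 2 := by field_simp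
  have i5 : Q ^ 2 / L - T * (P * Q) ≤ 1 / L * J := by
    refine le_trans (le_of_eq ?_) (mul_le_mul_of_nonneg_left e8 (by positivity : 0 ≤ 1 / L))
    field_simp
  have i6 : T * (P * Q) ≤ T * P ^ 2 / 2 + Q ^ 2 / L / 264 := by
    have h1 : T * Q ^ 2 = T * L * (Q ^ 2 / L) := by field_simp
    have h2 := mul_le_mul_of_nonneg_right hTL1 hS
    nlinarith [mul_nonneg hT0.le (sq_nonneg (P - Q))]
  have i7 : 2 * (μy / L * b) ≤ Q ^ 2 / L := by
    rw [le_div_iff₀ hL]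
    refine le_trans (le_of_eq ?_) e7
    field_simp
  have i8 : 2 * (μx * T * a) ≤ T * G ^ 2 := by
    linarith [mul_le_mul_of_nonneg_left e6 hT0.le]
  have i9 : μx * T * b ≤ μy / L * b / 132 := by
    have : μx * T ≤ μy / L / 132 :=
      (mul_le_mul_of_nonneg_right hμxL hT0.le).trans (by linarith)
    linarith [mul_le_mul_of_nonneg_right this hb0]
  have i10 : 0 ≤ μy / L * b := by positivity
  have i11 : 0 ≤ μx * T * a := by positivity
  rw [i4] at e3
  linarith

section TwoSided

variable {dx dy : ℕ} {f : EuclideanSpace ℝ (Fin dx) → EuclideanSpace ℝ (Fin dy) → ℝ}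
  {g : EuclideanSpace ℝ (Fin dx) → ℝ} {L μx μy : ℝ}

theorem LSmooth.norm_gradient_left_sub_le (hs : LSmooth f L) (hL : 0 < L)
    (x x' : EuclideanSpace ℝ (Fin dx)) (y : EuclideanSpace ℝ (Fin dy)) :
    ‖gradient (fun x => f x y) x - gradient (fun x => f x y) x'‖ ≤ L * ‖x - x'‖ := by
  have h := hs.2 x x' y y
  rw [sub_self y, norm_zero] at h
  refine (abs_le_of_sq_le_sq' ?_ (by positivity)).2
  nlinarith [sq_nonneg ‖gradient (f x) y - gradient (f x') y‖]

theorem LSmooth.norm_gradient_right_sub_le (hs : LSmooth f L) (hL : 0 < L)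
    (x : EuclideanSpace ℝ (Fin dx)) (y y' : EuclideanSpace ℝ (Fin dy)) :
    ‖gradient (f x) y - gradient (f x) y'‖ ≤ L * ‖y - y'‖ := by
  have h := hs.2 x x y y'
  rw [sub_self x, norm_zero] at h
  refine (abs_le_of_sq_le_sq' ?_ (by positivity)).2
  nlinarith [sq_nonneg ‖gradient (fun x => f x y) x - gradient (fun x => f x y') x‖]

theorem LSmooth.norm_gradient_right_sub_le' (hs : LSmooth f L) (hL : 0 < L)
    (x x' : EuclideanSpace ℝ (Fin dx)) (y : EuclideanSpace ℝ (Fin dy)) :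
    ‖gradient (f x) y - gradient (f x') y‖ ≤ L * ‖x - x'‖ := by
  have h := hs.2 x x' y y
  rw [sub_self y, norm_zero] at h
  refine (abs_le_of_sq_le_sq' ?_ (by positivity)).2
  nlinarith [sq_nonneg ‖gradient (fun x => f x y) x - gradient (fun x => f x y) x'‖]

theorem LSmooth.norm_neg_gradient_right_sub_le (hs : LSmooth f L) (hL : 0 < L)
    (x : EuclideanSpace ℝ (Fin dx)) (y y' : EuclideanSpace ℝ (Fin dy)) :
    ‖gradient (fun y => -f x y) y - gradient (fun y => -f x y) y'‖ ≤ L * ‖y - y'‖ := by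
  rw [gradient_fun_neg, gradient_fun_neg, neg_sub_neg, norm_sub_rev]
  exact hs.norm_gradient_right_sub_le hL x y y'

theorem le_iSup_of_maximizer (hg : ∀ x, g x = ⨆ y, f x y) (hatt : ∀ x, ∃ y, ∀ y', f x y' ≤ f x y)
    (x : EuclideanSpace ℝ (Fin dx)) (y : EuclideanSpace ℝ (Fin dy)) : f x y ≤ g x := by
  obtain ⟨w, hw⟩ := hatt x
  rw [hg]
  exact le_ciSup (f := f x) ⟨f x w, by rintro _ ⟨y', rfl⟩; exact hw y'⟩ y

theorem iInf_neg_eq (hg : ∀ x, g x = ⨆ y, f x y) (hatt : ∀ x, ∃ y, ∀ y', f x y' ≤ f x y)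
    (x : EuclideanSpace ℝ (Fin dx)) : ⨅ y, -f x y = -g x := by
  have hle := le_iSup_of_maximizer hg hatt x
  obtain ⟨w, hw⟩ := hatt x
  have hw' : g x ≤ f x w := by rw [hg]; exact ciSup_le hw
  refine le_antisymm ?_ (le_ciInf fun y => neg_le_neg (hle y))
  refine (ciInf_le ⟨-g x, ?_⟩ w).trans (neg_le_neg hw')
  rintro _ ⟨y, rfl⟩
  exact neg_le_neg (hle y)

theorem TwoSidedPL.two_mul_gap_le (hPL : TwoSidedPL f μx μy) (hg : ∀ x, g x = ⨆ y, f x y)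
    (hatt : ∀ x, ∃ y, ∀ y', f x y' ≤ f x y) (x : EuclideanSpace ℝ (Fin dx))
    (y : EuclideanSpace ℝ (Fin dy)) : 2 * μy * (g x - f x y) ≤ ‖gradient (f x) y‖ ^ 2 := by
  have h := (hPL.2 x).2.2 y
  rw [iInf_neg_eq hg hatt, gradient_fun_neg, norm_neg] at h
  linarith

theorem TwoSidedPL.exists_maximizer_near (hPL : TwoSidedPL f μx μy) (hμy : 0 < μy)
    (hg : ∀ x, g x = ⨆ y, f x y) (hatt : ∀ x, ∃ y, ∀ y', f x y' ≤ f x y)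
    (x : EuclideanSpace ℝ (Fin dx)) (y : EuclideanSpace ℝ (Fin dy)) :
    ∃ w, (∀ y', f x y' ≤ f x w) ∧ ‖y - w‖ ^ 2 ≤ 4 / μy * (g x - f x y) := by
  have hle := le_iSup_of_maximizer hg hatt x
  obtain ⟨w, hw, hd⟩ := exists_eq_min_of_PL hμy (hPL.2 x).1 (m := -g x)
    (fun z => neg_le_neg (hle z))
    (fun z => by rw [← iInf_neg_eq hg hatt]; exact (hPL.2 x).2.2 z) y
  have hw' : f x w = g x := neg_injective hw
  refine ⟨w, fun y' => (hle y').trans hw'.ge, ?_⟩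
  rwa [neg_sub_neg] at hd

theorem sq_norm_gradient_sup_sub_le (hμy : 0 < μy) (hs : LSmooth f L) (hPL : TwoSidedPL f μx μy)
    (hg : ∀ x, g x = ⨆ y, f x y) (hatt : ∀ x, ∃ y, ∀ y', f x y' ≤ f x y)
    (hgrad : ∀ x y, (∀ y', f x y' ≤ f x y) → gradient g x = gradient (fun x' => f x' y) x)
    (x : EuclideanSpace ℝ (Fin dx))
    (y : EuclideanSpace ℝ (Fin dy)) :
    ‖gradient g x - gradient (fun x => f x y) x‖ ^ 2 ≤ L ^ 2 * (4 / μy * (g x - f x y)) := by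
  obtain ⟨w, hw, hd⟩ := hPL.exists_maximizer_near hμy hg hatt x y
  have h := hs.2 x x w y
  rw [hgrad x w hw]
  rw [sub_self x, norm_zero, norm_sub_rev w y] at h
  nlinarith [sq_nonneg ‖gradient (f x) w - gradient (f x) y‖,
    mul_le_mul_of_nonneg_left hd (sq_nonneg L)]

theorem norm_gradient_sup_sub_le (hL : 0 < L) (hμy : 0 < μy) (hs : LSmooth f L) (hPL : TwoSidedPL f μx μy)
    (hg : ∀ x, g x = ⨆ y, f x y) (hatt : ∀ x, ∃ y, ∀ y', f x y' ≤ f x y)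
    (hgrad : ∀ x y, (∀ y', f x y' ≤ f x y) → gradient g x = gradient (fun x' => f x' y) x)
    (hμL : μy ≤ L) (x x' : EuclideanSpace ℝ (Fin dx)) :
    ‖gradient g x - gradient g x'‖ ≤ 2 * L ^ 2 / μy * ‖x - x'‖ := by
  obtain ⟨w, hw⟩ := hatt x
  obtain ⟨w', hw', hd⟩ := hPL.exists_maximizer_near hμy hg hatt x' w
  have hw0 : gradient (f x) w = 0 := by
    have := gradient_eq_zero_of_forall_le (h := fun y => -f x y) (fun y => neg_le_neg (hw y))
    rwa [gradient_fun_neg, neg_eq_zero] at this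
  have h1 := hPL.two_mul_gap_le hg hatt x' w
  have h2 := pow_le_pow_left₀ (norm_nonneg _) (hs.norm_gradient_right_sub_le' hL x x' w) 2
  rw [hw0, zero_sub, norm_neg, mul_pow] at h2
  have h3 : ‖w - w'‖ ^ 2 ≤ 2 * L ^ 2 / μy ^ 2 * ‖x - x'‖ ^ 2 := by
    have h5 : 4 / μy * (g x' - f x' w) = 2 / μy ^ 2 * (2 * μy * (g x' - f x' w)) := by
      field_simp; ring
    rw [h5] at hd
    refine hd.trans ((mul_le_mul_of_nonneg_left (h1.trans h2) (by positivity)).trans_eq (by ring))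
  have h4 := hs.2 x x' w w'
  rw [← hgrad x w hw, ← hgrad x' w' hw'] at h4
  refine (abs_le_of_sq_le_sq' ?_ (by positivity)).2
  have h6 : 1 ≤ L ^ 2 / μy ^ 2 := by
    rw [one_le_div (by positivity)]
    exact pow_le_pow_left₀ hμy.le hμL 2
  have h7 : (2 * L ^ 2 / μy * ‖x - x'‖) ^ 2
      = L ^ 2 * (4 * (L ^ 2 / μy ^ 2) * ‖x - x'‖ ^ 2) := by field_simp; ring
  rw [h7]
  have h8 : ‖x - x'‖ ^ 2 + ‖w - w'‖ ^ 2 ≤ 4 * (L ^ 2 / μy ^ 2) * ‖x - x'‖ ^ 2 := by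
    rw [mul_div_assoc] at h3
    nlinarith [sq_nonneg ‖x - x'‖]
  nlinarith [mul_le_mul_of_nonneg_left h8 (sq_nonneg L),
    sq_nonneg ‖gradient (f x) w - gradient (f x') w'‖]

theorem TwoSidedPL.two_mul_sup_gap_le (hPL : TwoSidedPL f μx μy) (hμx : 0 < μx)
    (hg : ∀ x, g x = ⨆ y, f x y) (hatt : ∀ x, ∃ y, ∀ y', f x y' ≤ f x y)
    (hgrad : ∀ x y, (∀ y', f x y' ≤ f x y) → gradient g x = gradient (fun x' => f x' y) x)
    (x : EuclideanSpace ℝ (Fin dx)) : 2 * μx * (g x - ⨅ x', g x') ≤ ‖gradient g x‖ ^ 2 := by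
  obtain ⟨w, hw⟩ := hatt x
  have h := (hPL.1 w).2.2 x
  rw [← hgrad x w hw] at h
  have h1 : g x ≤ f x w := by rw [hg]; exact ciSup_le hw
  have h2 : ⨅ x', f x' w ≤ ⨅ x', g x' :=
    ciInf_mono (hPL.1 w).2.1 fun x' => le_iSup_of_maximizer hg hatt x' w
  refine le_trans (mul_le_mul_of_nonneg_left ?_ (by positivity)) h
  linarith

/-- One step of simultaneous gradient descent-ascent contracts the Lyapunov function. -/
theorem lyapunov_contraction (hL : 0 < L) (hμx : 0 < μx) (hμy : 0 < μy) (hμxL : μx ≤ L)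
    (hμyL : μy ≤ L) (hs : LSmooth f L) (hPL : TwoSidedPL f μx μy)
    (hg : ∀ x, g x = ⨆ y, f x y) (hatt : ∀ x, ∃ y, ∀ y', f x y' ≤ f x y)
    (hbdd : BddBelow (Set.range g)) (hgdiff : Differentiable ℝ g)
    (hgrad : ∀ x y, (∀ y', f x y' ≤ f x y) → gradient g x = gradient (fun x' => f x' y) x)
    {T : ℝ} (hT : T = μy ^ 2 / (132 * L ^ 3))
    {x x' : EuclideanSpace ℝ (Fin dx)} {y y' : EuclideanSpace ℝ (Fin dy)}
    (hx : x' = x - T • gradient (fun x => f x y) x)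
    (hy : y' = y + (1 / L) • gradient (f x) y) :
    (g x' - ⨅ z, g z) + 1 / 22 * (g x' - f x' y') ≤
      (1 - μx * T / 2) * ((g x - ⨅ z, g z) + 1 / 22 * (g x - f x y)) := by
  have hT0 : 0 < T := by rw [hT]; positivity
  have ha0 : 0 ≤ g x - ⨅ z, g z := sub_nonneg.2 (ciInf_le hbdd x)
  have hb0 : 0 ≤ g x - f x y := sub_nonneg.2 (le_iSup_of_maximizer hg hatt x y)
  have e1 := image_le_add_inner_gradient hgdiff
    (norm_gradient_sup_sub_le hL hμy hs hPL hg hatt hgrad hμyL) x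
    (-(T • gradient (fun x => f x y) x))
  have e2 := image_le_add_inner_gradient (h := fun x => -f x y) (hPL.1 y).1.neg
    (fun z w => by
      rw [gradient_fun_neg, gradient_fun_neg, neg_sub_neg, norm_sub_rev]
      exact hs.norm_gradient_left_sub_le hL z w y) x (-(T • gradient (fun x => f x y) x))
  have e3 := image_le_add_inner_gradient (hPL.2 x').1 (hs.norm_neg_gradient_right_sub_le hL x') y
    ((1 / L) • gradient (f x) y)
  rw [← sub_eq_add_neg, ← hx] at e1 e2
  rw [← hy] at e3
  have e4 := hs.norm_gradient_right_sub_le' hL x x' y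
  have e5 := sq_norm_gradient_sup_sub_le hμy hs hPL hg hatt hgrad x y
  have e6 := hPL.two_mul_sup_gap_le hμx hg hatt hgrad x
  have e7 := hPL.two_mul_gap_le hg hatt x y
  have hxx : ‖x - x'‖ = T * ‖gradient (fun x => f x y) x‖ := by
    rw [hx, sub_sub_cancel, norm_smul, Real.norm_of_nonneg hT0.le]
  rw [hxx] at e4
  rw [gradient_fun_neg, inner_neg_neg, real_inner_smul_right, real_inner_self_eq_norm_sq] at e2
  rw [gradient_fun_neg, inner_neg_left, real_inner_smul_right] at e3
  rw [inner_neg_right, real_inner_smul_right] at e1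
  rw [norm_neg, norm_smul, Real.norm_of_nonneg hT0.le] at e1 e2
  rw [norm_smul, Real.norm_of_nonneg (by positivity : 0 ≤ 1 / L)] at e3
  rw [norm_sub_sq_real] at e5
  have e8 : ‖gradient (f x) y‖ ^ 2 - T * L * (‖gradient (fun x => f x y) x‖ * ‖gradient (f x) y‖)
      ≤ inner ℝ (gradient (f x') y) (gradient (f x) y) := by
    have h1 := real_inner_le_norm (gradient (f x) y - gradient (f x') y) (gradient (f x) y)
    rw [inner_sub_left, real_inner_self_eq_norm_sq] at h1
    nlinarith [mul_le_mul_of_nonneg_right e4 (norm_nonneg (gradient (f x) y))]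
  have e9 := lyapunov_scalar_contraction hL hμx hμy hμxL hμyL hT ha0 hb0
    (g' := g x' - ⨅ z, g z) (f₀ := f x y - ⨅ z, g z) (f₁ := f x' y - ⨅ z, g z)
    (f₂ := f x' y' - ⨅ z, g z)
    (by ring) (by linarith only [e1]) (by linarith only [e2]) (by linarith only [e3])
    e5 e6 e7 e8
  linarith only [e9]

/-- The squared lengths of the two gradient steps are controlled by the Lyapunov function. -/
theorem sq_norm_gradient_step_le (hL : 0 < L) (hμy : 0 < μy)
    (hμyL : μy ≤ L) (hs : LSmooth f L) (hPL : TwoSidedPL f μx μy)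
    (hg : ∀ x, g x = ⨆ y, f x y) (hatt : ∀ x, ∃ y, ∀ y', f x y' ≤ f x y)
    (hbdd : BddBelow (Set.range g)) (hgdiff : Differentiable ℝ g)
    (hgrad : ∀ x y, (∀ y', f x y' ≤ f x y) → gradient g x = gradient (fun x' => f x' y) x)
    {T : ℝ} (hT : T = μy ^ 2 / (132 * L ^ 3))
    (x : EuclideanSpace ℝ (Fin dx)) (y : EuclideanSpace ℝ (Fin dy)) :
    ‖T • gradient (fun x => f x y) x‖ ^ 2 ≤
        1 / L * ((g x - ⨅ z, g z) + 1 / 22 * (g x - f x y)) ∧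
      ‖(1 / L) • gradient (f x) y‖ ^ 2 ≤
        44 / L * ((g x - ⨅ z, g z) + 1 / 22 * (g x - f x y)) := by
  have ha0 : 0 ≤ g x - ⨅ z, g z := sub_nonneg.2 (ciInf_le hbdd x)
  have hb0 : 0 ≤ g x - f x y := sub_nonneg.2 (le_iSup_of_maximizer hg hatt x y)
  have hr : μy / L ≤ 1 := (div_le_one hL).2 hμyL
  have hr0 : 0 < μy / L := by positivity
  rw [norm_smul, norm_smul, mul_pow, mul_pow, Real.norm_eq_abs, Real.norm_eq_abs, sq_abs, sq_abs]
  constructor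
  · have h1 := sq_norm_gradient_sup_sub_le hμy hs hPL hg hatt hgrad x y
    have h2 := sq_norm_gradient_le (m := ⨅ z, g z) (by positivity : 0 < 2 * L ^ 2 / μy) hgdiff
      (norm_gradient_sup_sub_le hL hμy hs hPL hg hatt hgrad hμyL) (ciInf_le hbdd) x
    set p := gradient (fun x => f x y) x with hp
    have h3 : ‖p‖ ^ 2 ≤ 2 * ‖gradient g x‖ ^ 2 + 2 * ‖gradient g x - p‖ ^ 2 := by
      have := parallelogram_law_with_norm ℝ (gradient g x) (gradient g x - p)
      rw [sub_sub_cancel] at this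
      nlinarith [sq_nonneg ‖gradient g x + (gradient g x - p)‖]
    have h4 : ‖p‖ ^ 2 ≤ 176 * L ^ 2 / μy * ((g x - ⨅ z, g z) + 1 / 22 * (g x - f x y)) := by
      have h5 : 0 ≤ L ^ 2 / μy * (g x - ⨅ z, g z) := by positivity
      have h6 : 2 * (2 * L ^ 2 / μy) * (g x - ⨅ z, g z) = 4 * (L ^ 2 / μy * (g x - ⨅ z, g z)) := by
        ring
      have h7 : L ^ 2 * (4 / μy * (g x - f x y)) = 4 * (L ^ 2 / μy * (g x - f x y)) := by ring
      have h8 : 176 * L ^ 2 / μy * ((g x - ⨅ z, g z) + 1 / 22 * (g x - f x y)) =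
        176 * (L ^ 2 / μy * (g x - ⨅ z, g z)) + 8 * (L ^ 2 / μy * (g x - f x y)) := by ring
      linarith
    refine (mul_le_mul_of_nonneg_left h4 (sq_nonneg T)).trans ?_
    rw [← mul_assoc]
    refine mul_le_mul_of_nonneg_right ?_ (by positivity)
    have h9 : T ^ 2 * (176 * L ^ 2 / μy) = (μy / L) ^ 3 * (176 / 132 ^ 2) * (1 / L) := by
      rw [hT]; field_simp
    rw [h9]
    have h10 := pow_le_one₀ (n := 3) hr0.le hr
    refine mul_le_of_le_one_left (by positivity) ?_
    linarith
  · have h1 := sq_norm_gradient_le (m := -g x) hL (hPL.2 x).1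
      (hs.norm_neg_gradient_right_sub_le hL x)
      (fun z => neg_le_neg (le_iSup_of_maximizer hg hatt x z)) y
    rw [gradient_fun_neg, norm_neg, neg_sub_neg] at h1
    refine (mul_le_mul_of_nonneg_left h1 (sq_nonneg (1 / L))).trans ?_
    have h2 : (1 / L) ^ 2 * (2 * L * (g x - f x y)) = 44 / L * (1 / 22 * (g x - f x y)) := by
      ring_nf; field_simp
    rw [h2]
    exact mul_le_mul_of_nonneg_left (by linarith) (by positivity)

theorem isSaddle_of_gap_eq_zero (hμx : 0 < μx) (hPL : TwoSidedPL f μx μy)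
    (hg : ∀ x, g x = ⨆ y, f x y) (hatt : ∀ x, ∃ y, ∀ y', f x y' ≤ f x y)
    (hbdd : BddBelow (Set.range g))
    (hgrad : ∀ x y, (∀ y', f x y' ≤ f x y) → gradient g x = gradient (fun x' => f x' y) x)
    {x : EuclideanSpace ℝ (Fin dx)} {y : EuclideanSpace ℝ (Fin dy)}
    (hx : g x = ⨅ z, g z) (hy : g x = f x y) : IsSaddle f (x, y) := by
  have hmax : ∀ y', f x y' ≤ f x y := fun y' => hy ▸ le_iSup_of_maximizer hg hatt x y'
  have h0 : gradient g x = 0 := gradient_eq_zero_of_forall_le fun w => hx ▸ ciInf_le hbdd w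
  have h1 := (hPL.1 y).2.2 x
  rw [← hgrad x y hmax, h0, norm_zero] at h1
  have h2 : f x y ≤ ⨅ z, f z y := by nlinarith
  exact fun x' y' => ⟨hmax y', h2.trans (ciInf_le (hPL.1 y).2.1 x')⟩

end TwoSided

end PolyakLojasiewicz

theorem stmt8 {dx dy : ℕ} (f : EuclideanSpace ℝ (Fin dx) → EuclideanSpace ℝ (Fin dy) → ℝ)
    (L μx μy : ℝ) (hL : 0 < L) (hμx : 0 < μx) (hμy : 0 < μy)
    (hμxL : μx ≤ L) (hμyL : μy ≤ L)
    (hsmooth : LSmooth f L)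
    (hPL : TwoSidedPL f μx μy)
    (g : EuclideanSpace ℝ (Fin dx) → ℝ) (hg : ∀ x, g x = ⨆ y, f x y)
    (hatt : ∀ x, ∃ y, ∀ y', f x y' ≤ f x y)
    (hbdd : BddBelow (Set.range g))
    (hgdiff : Differentiable ℝ g)
    (hgrad : ∀ x y, (∀ y', f x y' ≤ f x y) →
      gradient g x = gradient (fun x' => f x' y) x)
    (τx τy lam : ℝ) (hτy : τy = 1 / L) (hlam : lam = 6 * L ^ 2 / μy ^ 2)
    (hτx : τx = τy / (22 * lam))
    (x : ℕ → EuclideanSpace ℝ (Fin dx)) (y : ℕ → EuclideanSpace ℝ (Fin dy))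
    (hxiter : ∀ k, x (k + 1) = x k - τx • gradient (fun x' => f x' (y k)) (x k))
    (hyiter : ∀ k, y (k + 1) = y k + τy • gradient (f (x k)) (y k)) :
    ∃ p : EuclideanSpace ℝ (Fin dx) × EuclideanSpace ℝ (Fin dy), IsSaddle f p ∧
      ∀ k, ‖x k - p.1‖ ^ 2 + ‖y k - p.2‖ ^ 2 ≤
        2 * (1 - μx * τx / 2) ^ k / (1 - Real.sqrt (1 - μx * τx / 2)) ^ 2 *
          max (4 / μx) (88 / μy) *
          ((g (x 0) - ⨅ x', g x') + lam * τx / τy * (g (x 0) - f (x 0) (y 0))) := by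
  have hT : τx = μy ^ 2 / (132 * L ^ 3) := by
    rw [hτx, hτy, hlam]; field_simp; norm_num
  have hT0 : 0 < τx := by rw [hT]; positivity
  have hweight : lam * τx / τy = 1 / 22 := by
    have hlam0 : 0 < lam := by rw [hlam]; positivity
    have hτy0 : 0 < τy := by rw [hτy]; positivity
    rw [hτx]; field_simp
  rw [hweight]
  set V : ℕ → ℝ := fun k => (g (x k) - ⨅ z, g z) + 1 / 22 * (g (x k) - f (x k) (y k)) with hV
  change ∃ p : EuclideanSpace ℝ (Fin dx) × EuclideanSpace ℝ (Fin dy), IsSaddle f p ∧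
      ∀ k, ‖x k - p.1‖ ^ 2 + ‖y k - p.2‖ ^ 2 ≤
        2 * (1 - μx * τx / 2) ^ k / (1 - Real.sqrt (1 - μx * τx / 2)) ^ 2 *
          max (4 / μx) (88 / μy) * V 0
  have ha0 (z) : 0 ≤ g z - ⨅ z, g z := sub_nonneg.2 (ciInf_le hbdd z)
  have hb0 (z w) : 0 ≤ g z - f z w := sub_nonneg.2 (le_iSup_of_maximizer hg hatt z w)
  have hV0 (k) : 0 ≤ V k := add_nonneg (ha0 _) (mul_nonneg (by norm_num) (hb0 _ _))
  have hμT : μx * τx ≤ 1 := by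
    have h1 : L * τx = (μy / L) ^ 2 / 132 := by rw [hT]; field_simp
    have h2 : (μy / L) ^ 2 ≤ 1 := pow_le_one₀ (by positivity) ((div_le_one hL).2 hμyL)
    nlinarith
  have hμT0 : 0 < μx * τx := by positivity
  set c := 1 - μx * τx / 2 with hc
  have hc0 : 0 ≤ c := by linarith
  have hc1 : c < 1 := by linarith
  have hstep (k) : V (k + 1) ≤ c * V k :=
    lyapunov_contraction hL hμx hμy hμxL hμyL hsmooth hPL hg hatt hbdd hgdiff hgrad hT
      (hxiter k) (hτy ▸ hyiter k)
  have hgeom (k) : V k ≤ V 0 * c ^ k := by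
    induction k with
    | zero => simp
    | succ k ih =>
      refine (hstep k).trans ((mul_le_mul_of_nonneg_left ih hc0).trans_eq ?_)
      ring
  have hlen (k) := sq_norm_gradient_step_le hL hμy hμyL hsmooth hPL hg hatt hbdd hgdiff hgrad hT
    (x k) (y k)
  obtain ⟨xs, hxs, hxd⟩ := exists_limit_of_sq_norm_sub_le_geometric (u := x)
    (A := 1 / L * V 0) (mul_nonneg (by positivity) (hV0 0)) hc0 hc1 (fun k => by
      rw [hxiter k, sub_sub_cancel_left, norm_neg, mul_assoc]
      exact (hlen k).1.trans (mul_le_mul_of_nonneg_left (hgeom k) (by positivity)))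
  obtain ⟨ys, hys, hyd⟩ := exists_limit_of_sq_norm_sub_le_geometric (u := y)
    (A := 44 / L * V 0) (mul_nonneg (by positivity) (hV0 0)) hc0 hc1 (fun k => by
      rw [hyiter k, add_sub_cancel_left, hτy, mul_assoc]
      exact (hlen k).2.trans (mul_le_mul_of_nonneg_left (hgeom k) (by positivity)))
  have hVlim : Filter.Tendsto V Filter.atTop (nhds 0) := by
    refine squeeze_zero hV0 hgeom ?_
    simpa using (tendsto_pow_atTop_nhds_zero_of_lt_one hc0 hc1).const_mul (V 0)
  have hVlim' : Filter.Tendsto V Filter.atTop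
      (nhds ((g xs - ⨅ z, g z) + 1 / 22 * (g xs - f xs ys))) := by
    have h1 := (hgdiff.continuous.tendsto xs).comp hxs
    have h2 := (hsmooth.1.continuous.tendsto (xs, ys)).comp (hxs.prodMk_nhds hys)
    exact (h1.sub_const _).add ((h1.sub h2).const_mul _)
  have hzero := tendsto_nhds_unique hVlim' hVlim
  refine ⟨(xs, ys), isSaddle_of_gap_eq_zero hμx hPL hg hatt hbdd hgrad ?_ ?_, fun k => ?_⟩
  · linarith [ha0 xs, hb0 xs ys]
  · linarith [ha0 xs, hb0 xs ys]
  · refine (add_le_add (hxd k) (hyd k)).trans ?_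
    have h1 : 45 / L ≤ 2 * max (4 / μx) (88 / μy) := by
      have h2 : 45 / L ≤ 45 / μy := div_le_div_of_nonneg_left (by norm_num) hμy hμyL
      have h3 : 45 / μy ≤ 88 / μy := div_le_div_of_nonneg_right (by norm_num) hμy.le
      have h4 : 0 < 88 / μy := by positivity
      linarith [le_max_right (4 / μx) (88 / μy)]
    have h5 : 0 ≤ V 0 * c ^ k / (1 - √c) ^ 2 :=
      div_nonneg (mul_nonneg (hV0 0) (pow_nonneg hc0 k)) (sq_nonneg _)
    calc _ = 45 / L * (V 0 * c ^ k / (1 - √c) ^ 2) := by ring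
      _ ≤ 2 * max (4 / μx) (88 / μy) * (V 0 * c ^ k / (1 - √c) ^ 2) :=
        mul_le_mul_of_nonneg_right h1 h5
      _ = _ := by ring
end
end

section
/- Let f : ℝ^{d_x} × ℝ^{d_y} → ℝ be L-smooth (L > 0) and suppose −f(x, ·) is μ_y-PL for every x with 0 < μ_y ≤ L. Let g(x) := sup_y f(x,y); assume this supremum is attained for every x and g* := inf_x g(x) is finite. Assume g is differentiable and ∇g(x) = ∇_x f(x, ŷ) for every x and every maximizer ŷ of f(x, ·). Set τ_y = 1/L, λ = 4L²/μ_y², τ_x = τ_y/(18λ) = μ_y²/(72L³), and define the simultaneous GDA iterates x_{k+1} = x_k − τ_x ∇_x f(x_k, y_k), y_{k+1} = y_k + τ_y ∇_y f(x_k, y_k). Then for every K ≥ 1, (1/K) Σ_{k=0}^{K−1} ‖∇g(x_k)‖² ≤ (288 L³ / (K μ_y²)) · V_0, where V_0 = (g(x_0) − g*) + (λτ_x/τ_y)(g(x_0) − f(x_0, y_0)). -/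
noncomputable section

open Filter Topology Set

/-- A real function whose derivative grows at most linearly from `0` satisfies the quadratic
upper bound at `1`. -/
lemma le_quadratic_of_deriv_le {φ φ' : ℝ → ℝ} {C : ℝ} (hφ : ∀ t, HasDerivAt φ (φ' t) t)
    (hC : ∀ t, 0 ≤ t → φ' t ≤ φ' 0 + C * t) : φ 1 ≤ φ 0 + φ' 0 + C / 2 := by
  have hψ : ∀ t, HasDerivAt (fun t => φ t - φ' 0 * t - C / 2 * t ^ 2)
      (φ' t - φ' 0 - C * t) t := by
    intro t
    have h := ((hφ t).sub ((hasDerivAt_id t).const_mul (φ' 0))).sub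
      (((hasDerivAt_id t).pow 2).const_mul (C / 2))
    refine h.congr_deriv ?_
    simp
    ring
  have hanti := antitoneOn_of_deriv_nonpos (convex_Icc (0 : ℝ) 1)
    (fun t _ => (hψ t).continuousAt.continuousWithinAt)
    (fun t _ => (hψ t).differentiableAt.differentiableWithinAt)
    (fun t ht => by
      rw [interior_Icc] at ht
      rw [(hψ t).deriv]
      linarith [hC t ht.1.le])
  have h := hanti (left_mem_Icc.2 zero_le_one) (right_mem_Icc.2 zero_le_one) zero_le_one
  simp only at h
  linarith

section InnerProduct

variable {E : Type*} [NormedAddCommGroup E] [InnerProductSpace ℝ E] [FiniteDimensional ℝ E]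

/-- The derivative of a differentiable function along a line, in terms of its gradient. -/
lemma hasDerivAt_along_line {h : E → ℝ} (hd : Differentiable ℝ h) (z v : E) (t : ℝ) :
    HasDerivAt (fun t : ℝ => h (z + t • v)) (inner ℝ (gradient h (z + t • v)) v) t := by
  have h1 : HasDerivAt (fun t : ℝ => z + t • v) v t := by
    simpa using ((hasDerivAt_id t).smul_const v).const_add z
  have h2 := (hd (z + t • v)).hasGradientAt.hasFDerivAt
  simpa [Function.comp_def] using h2.comp_hasDerivAt t h1

/-- The descent lemma for a function with `M`-Lipschitz gradient. -/
lemma descent_of_gradient_lipschitz {h : E → ℝ} (hd : Differentiable ℝ h) {M : ℝ}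
    (hM : ∀ z w, ‖gradient h z - gradient h w‖ ≤ M * ‖z - w‖) (z v : E) :
    h (z + v) ≤ h z + inner ℝ (gradient h z) v + M / 2 * ‖v‖ ^ 2 := by
  have key := le_quadratic_of_deriv_le (C := M * ‖v‖ ^ 2) (hasDerivAt_along_line hd z v) (by
    intro t ht
    have h1 := real_inner_le_norm (gradient h (z + t • v) - gradient h (z + (0 : ℝ) • v)) v
    rw [inner_sub_left] at h1
    have h2 := hM (z + t • v) (z + (0 : ℝ) • v)
    have h3 : ‖z + t • v - (z + (0 : ℝ) • v)‖ = t * ‖v‖ := by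
      simp [norm_smul, abs_of_nonneg ht]
    rw [h3] at h2
    nlinarith [mul_le_mul_of_nonneg_right h2 (norm_nonneg v)])
  simp only [one_smul, zero_smul, add_zero] at key
  linarith

/-- The Polyak–Łojasiewicz inequality implies that minimizers exist near every point: quadratic
growth, with a constant that is enough here. -/
lemma exists_minimizer_near_of_PL {h : E → ℝ} (hd : Differentiable ℝ h) {μ m : ℝ} (hμ : 0 < μ)
    (hm : ∀ z, m ≤ h z) (hPL : ∀ z, 2 * μ * (h z - m) ≤ ‖gradient h z‖ ^ 2) (z₀ : E) :
    ∃ z, h z = m ∧ μ * ‖z - z₀‖ ^ 2 ≤ 4 * (h z₀ - m) := by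
  set c : ℝ := √(μ / 4) with hc
  have hcpos : 0 < c := Real.sqrt_pos.2 (by positivity)
  have hcsq : c ^ 2 = μ / 4 := Real.sq_sqrt (by positivity)
  obtain ⟨z, hz⟩ : ∃ z, ∀ w, √(h z - m) + c * dist z z₀ ≤ √(h w - m) + c * dist w z₀ := by
    refine Continuous.exists_forall_le (β := E)
      (f := fun z => √(h z - m) + c * dist z z₀) ?_ ?_
    · have := hd.continuous
      fun_prop
    · exact tendsto_atTop_mono (fun w => le_add_of_nonneg_left (Real.sqrt_nonneg _))
        ((tendsto_dist_right_cocompact_atTop z₀).const_mul_atTop hcpos)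
  have hzm : h z = m := by
    by_contra hne
    have hpos : 0 < h z - m := sub_pos.2 (lt_of_le_of_ne (hm z) (Ne.symm hne))
    set s := √(h z - m) with hs
    have hspos : 0 < s := Real.sqrt_pos.2 hpos
    have hssq : s ^ 2 = h z - m := Real.sq_sqrt hpos.le
    set v := gradient h z with hv
    have hder : HasDerivAt (fun t : ℝ => √(h (z + t • (-v)) - m))
        (inner ℝ v (-v) / (2 * s)) 0 := by
      have h1 := (hasDerivAt_along_line hd z (-v) 0).sub_const m
      have h2 := h1.sqrt (by simpa using hpos.ne')
      refine (h2.congr_deriv ?_)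
      simp [hs, hv]
    have hlim := hder.tendsto_slope_zero_right
    have hge : -(c * ‖v‖) ≤ inner ℝ v (-v) / (2 * s) := by
      refine ge_of_tendsto hlim ?_
      filter_upwards [self_mem_nhdsWithin] with t ht
      have ht : 0 < t := ht
      have h1 := hz (z + t • (-v))
      have h2 : dist (z + t • (-v)) z₀ ≤ t * ‖v‖ + dist z z₀ := by
        refine (dist_triangle _ z _).trans (add_le_add_left (le_of_eq ?_) _)
        simp [dist_eq_norm, norm_smul, abs_of_pos ht]
      simp only [zero_add, zero_smul, add_zero, smul_eq_mul]
      rw [inv_mul_eq_div, le_div_iff₀ ht]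
      nlinarith [mul_le_mul_of_nonneg_left h2 hcpos.le]
    rw [inner_neg_right, real_inner_self_eq_norm_sq, le_div_iff₀ (by positivity)] at hge
    have hp := hPL z
    rw [← hv, ← hssq] at hp
    have hvpos : 0 < ‖v‖ := by
      by_contra h0
      have : ‖v‖ = 0 := le_antisymm (not_lt.1 h0) (norm_nonneg _)
      rw [this] at hp
      have : 0 < μ * s ^ 2 := by positivity
      nlinarith
    have h1 : ‖v‖ ≤ 2 * c * s := by
      refine le_of_mul_le_mul_right ?_ hvpos
      nlinarith
    have h2 : ‖v‖ ^ 2 ≤ (2 * c * s) ^ 2 := pow_le_pow_left₀ hvpos.le h1 2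
    have h3 : (2 * c * s) ^ 2 = μ * s ^ 2 := by rw [mul_pow, mul_pow, hcsq]; ring
    have : 0 < μ * s ^ 2 := by positivity
    linarith
  refine ⟨z, hzm, ?_⟩
  have h1 := hz z₀
  rw [hzm, sub_self, Real.sqrt_zero, zero_add, dist_self, mul_zero, add_zero, dist_eq_norm] at h1
  have h2 := pow_le_pow_left₀ (by positivity) h1 2
  rw [mul_pow, hcsq, Real.sq_sqrt (sub_nonneg.2 (hm z₀))] at h2
  linarith

end InnerProduct

/-- The quadratic lower bound for a jointly `L`-smooth function. -/
lemma LSmooth.quadratic_lower_bound {dx dy : ℕ}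
    {f : EuclideanSpace ℝ (Fin dx) → EuclideanSpace ℝ (Fin dy) → ℝ} {L : ℝ} (hL : 0 ≤ L)
    (hf : LSmooth f L) (x u : EuclideanSpace ℝ (Fin dx)) (y v : EuclideanSpace ℝ (Fin dy)) :
    f x y + inner ℝ (gradient (fun x' => f x' y) x) u + inner ℝ (gradient (f x) y) v
      - L / 2 * (‖u‖ ^ 2 + ‖v‖ ^ 2) ≤ f (x + u) (y + v) := by
  have hder : ∀ t : ℝ, HasDerivAt (fun t : ℝ => -f (x + t • u) (y + t • v))
      (-(inner ℝ (gradient (fun x' => f x' (y + t • v)) (x + t • u)) u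
        + inner ℝ (gradient (f (x + t • u)) (y + t • v)) v)) t := by
    intro t
    have hF := (hf.1 (x + t • u, y + t • v)).hasFDerivAt
    set F' := fderiv ℝ (fun p : EuclideanSpace ℝ (Fin dx) × EuclideanSpace ℝ (Fin dy) =>
      f p.1 p.2) (x + t • u, y + t • v)
    have hline : HasDerivAt (fun t : ℝ => (x + t • u, y + t • v)) (u, v) t := by
      refine HasDerivAt.prodMk ?_ ?_
      · simpa using ((hasDerivAt_id t).smul_const u).const_add x
      · simpa using ((hasDerivAt_id t).smul_const v).const_add y
    have hx : HasFDerivAt (fun x' => f x' (y + t • v)) (F'.comp (ContinuousLinearMap.inl ℝ _ _))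
        (x + t • u) := HasFDerivAt.comp (f := fun x' => (x', y + t • v))
        (g := fun p => f p.1 p.2) (x + t • u) hF (hasFDerivAt_prodMk_left (x + t • u) (y + t • v))
    have hy : HasFDerivAt (f (x + t • u)) (F'.comp (ContinuousLinearMap.inr ℝ _ _))
        (y + t • v) := hF.comp (y + t • v) (hasFDerivAt_prodMk_right (x + t • u) (y + t • v))
    refine (hF.comp_hasDerivAt t hline).neg.congr_deriv ?_
    have e1 : inner ℝ (gradient (fun x' => f x' (y + t • v)) (x + t • u)) u = F' (u, 0) := by
      simp [gradient, hx.fderiv]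
    have e2 : inner ℝ (gradient (f (x + t • u)) (y + t • v)) v = F' (0, v) := by
      simp [gradient, hy.fderiv]
    rw [e1, e2, ← map_add]
    simp
  have key := le_quadratic_of_deriv_le (C := L * (‖u‖ ^ 2 + ‖v‖ ^ 2)) hder (by
    intro t ht
    have hs := hf.2 (x + (0 : ℝ) • u) (x + t • u) (y + (0 : ℝ) • v) (y + t • v)
    have h1 := real_inner_le_norm (gradient (fun x' => f x' (y + (0 : ℝ) • v)) (x + (0 : ℝ) • u)
      - gradient (fun x' => f x' (y + t • v)) (x + t • u)) u
    have h2 := real_inner_le_norm (gradient (f (x + (0 : ℝ) • u)) (y + (0 : ℝ) • v)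
      - gradient (f (x + t • u)) (y + t • v)) v
    rw [inner_sub_left] at h1 h2
    have n1 : ‖x + (0 : ℝ) • u - (x + t • u)‖ = t * ‖u‖ := by
      simp [norm_smul, abs_of_nonneg ht]
    have n2 : ‖y + (0 : ℝ) • v - (y + t • v)‖ = t * ‖v‖ := by
      simp [norm_smul, abs_of_nonneg ht]
    rw [n1, n2] at hs
    set A := ‖gradient (fun x' => f x' (y + (0 : ℝ) • v)) (x + (0 : ℝ) • u)
      - gradient (fun x' => f x' (y + t • v)) (x + t • u)‖
    set B := ‖gradient (f (x + (0 : ℝ) • u)) (y + (0 : ℝ) • v)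
      - gradient (f (x + t • u)) (y + t • v)‖
    have hAB : A * ‖u‖ + B * ‖v‖ ≤ L * (‖u‖ ^ 2 + ‖v‖ ^ 2) * t := by
      refine abs_le_of_sq_le_sq' (a := A * ‖u‖ + B * ‖v‖) ?_ (by positivity) |>.2
      have c1 : (A * ‖u‖ + B * ‖v‖) ^ 2 ≤ (A ^ 2 + B ^ 2) * (‖u‖ ^ 2 + ‖v‖ ^ 2) := by
        nlinarith [sq_nonneg (A * ‖v‖ - B * ‖u‖)]
      have c2 := mul_le_mul_of_nonneg_right hs
        (show 0 ≤ ‖u‖ ^ 2 + ‖v‖ ^ 2 by positivity)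
      nlinarith
    linarith)
  simp only [one_smul, zero_smul, add_zero] at key
  linarith

/-- The scalar inequality behind the decrease of the Lyapunov function in one step: `N`, `G`, `H`
are the norms of `∇g`, `∇ₓf`, `∇ᵧf`, and `I` is the inner product of the first two. -/
lemma lyapunov_decrease {L μ τ g₀ g₁ f₀ f₁ N G H I : ℝ} (hL : 0 < L) (hμ : 0 < μ)
    (hμL : μ ≤ L) (hτ : τ = μ ^ 2 / (72 * L ^ 3)) (hb : f₀ ≤ g₀)
    (hd : g₁ ≤ g₀ + -(τ * I) + 2 * L ^ 2 / μ / 2 * (τ * G) ^ 2)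
    (hf : f₀ + -(τ * G ^ 2) + 1 / L * H ^ 2 - L / 2 * ((τ * G) ^ 2 + (1 / L * H) ^ 2) ≤ f₁)
    (hp : 2 * μ * (g₀ - f₀) ≤ H ^ 2)
    (hc : μ * (N ^ 2 - 2 * I + G ^ 2) ≤ 4 * L ^ 2 * (g₀ - f₀)) :
    τ / 4 * N ^ 2 ≤ (g₀ + 1 / 18 * (g₀ - f₀)) - (g₁ + 1 / 18 * (g₁ - f₁)) := by
  have hLτ : L * τ ≤ 1 / 72 := by
    have : L * τ = μ ^ 2 / (72 * L ^ 2) := by rw [hτ]; field_simp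
    rw [this, div_le_div_iff₀ (by positivity) (by norm_num)]
    nlinarith
  have hMτ : 2 * L ^ 2 / μ * τ ≤ 1 / 36 := by
    have : 2 * L ^ 2 / μ * τ = μ / (36 * L) := by rw [hτ]; field_simp; ring
    rw [this, div_le_div_iff₀ (by positivity) (by norm_num)]
    nlinarith
  have hτpos : 0 < τ := by rw [hτ]; positivity
  have hb0 : 0 ≤ g₀ - f₀ := sub_nonneg.2 hb
  have p1 : 0 ≤ μ / L * (g₀ - f₀) := by positivity
  have p2 : 0 ≤ τ * G ^ 2 := by positivity
  have p3 : 0 ≤ τ * N ^ 2 := by positivity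
  have hd' : g₁ ≤ g₀ - τ * I + 1 / 72 * (τ * G ^ 2) := by
    have h1 := mul_le_mul_of_nonneg_right hMτ p2
    have h2 : 2 * L ^ 2 / μ / 2 * (τ * G) ^ 2 = 1 / 2 * (2 * L ^ 2 / μ * τ * (τ * G ^ 2)) := by
      ring
    linarith
  have hf' : f₀ - 145 / 144 * (τ * G ^ 2) + 1 / (2 * L) * H ^ 2 ≤ f₁ := by
    have h1 := mul_le_mul_of_nonneg_right hLτ p2
    have h2 : 1 / L * H ^ 2 - L / 2 * (1 / L * H) ^ 2 = 1 / (2 * L) * H ^ 2 := by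
      field_simp; ring
    have h3 : L / 2 * ((τ * G) ^ 2 + (1 / L * H) ^ 2) =
        1 / 2 * (L * τ * (τ * G ^ 2)) + L / 2 * (1 / L * H) ^ 2 := by ring
    linarith
  have hp' : μ / L * (g₀ - f₀) ≤ 1 / (2 * L) * H ^ 2 := by
    have : μ / L * (g₀ - f₀) = 1 / (2 * L) * (2 * μ * (g₀ - f₀)) := by field_simp
    rw [this]
    exact mul_le_mul_of_nonneg_left hp (by positivity)
  have hc' : τ * (N ^ 2 - 2 * I + G ^ 2) ≤ 1 / 18 * (μ / L * (g₀ - f₀)) := by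
    have h1 : τ * (N ^ 2 - 2 * I + G ^ 2) = τ / μ * (μ * (N ^ 2 - 2 * I + G ^ 2)) := by
      field_simp
    have h2 : 1 / 18 * (μ / L * (g₀ - f₀)) = τ / μ * (4 * L ^ 2 * (g₀ - f₀)) := by
      rw [hτ]; field_simp; ring
    rw [h1, h2]
    exact mul_le_mul_of_nonneg_left hc (by positivity)
  linarith

theorem stmt9 {dx dy : ℕ} (f : EuclideanSpace ℝ (Fin dx) → EuclideanSpace ℝ (Fin dy) → ℝ)
    (L μy : ℝ) (hL : 0 < L) (hμy : 0 < μy) (hμyL : μy ≤ L)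
    (hsmooth : LSmooth f L)
    (hPLy : ∀ x, IsPL (fun y => -f x y) μy)
    (g : EuclideanSpace ℝ (Fin dx) → ℝ) (hg : ∀ x, g x = ⨆ y, f x y)
    (hatt : ∀ x, ∃ y, ∀ y', f x y' ≤ f x y)
    (hbdd : BddBelow (Set.range g))
    (hgdiff : Differentiable ℝ g)
    (hgrad : ∀ x y, (∀ y', f x y' ≤ f x y) →
      gradient g x = gradient (fun x' => f x' y) x)
    (τx τy lam : ℝ) (hτy : τy = 1 / L) (hlam : lam = 4 * L ^ 2 / μy ^ 2)
    (hτx : τx = τy / (18 * lam))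
    (x : ℕ → EuclideanSpace ℝ (Fin dx)) (y : ℕ → EuclideanSpace ℝ (Fin dy))
    (hxiter : ∀ k, x (k + 1) = x k - τx • gradient (fun x' => f x' (y k)) (x k))
    (hyiter : ∀ k, y (k + 1) = y k + τy • gradient (f (x k)) (y k)) :
    ∀ K : ℕ, 1 ≤ K →
      (1 / (K : ℝ)) * ∑ k ∈ Finset.range K, ‖gradient g (x k)‖ ^ 2 ≤
        288 * L ^ 3 / ((K : ℝ) * μy ^ 2) *
          ((g (x 0) - ⨅ x', g x') + lam * τx / τy * (g (x 0) - f (x 0) (y 0))) := by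
  have hgle : ∀ x y, f x y ≤ g x := by
    intro x y
    obtain ⟨ys, hys⟩ := hatt x
    rw [hg]
    exact le_ciSup (f := fun y => f x y) ⟨f x ys, by rintro _ ⟨w, rfl⟩; exact hys w⟩ y
  have hmax : ∀ x y, f x y = g x → ∀ y', f x y' ≤ f x y := fun x y h y' => h ▸ hgle x y'
  have hgneg : ∀ x y, gradient (fun y' => -f x y') y = -gradient (f x) y := by
    intro x y
    simp only [gradient, fderiv_fun_neg, map_neg]
  have hPL : ∀ x y, 2 * μy * (g x - f x y) ≤ ‖gradient (f x) y‖ ^ 2 := by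
    intro x y
    obtain ⟨ys, hys⟩ := hatt x
    have h := (hPLy x).2.2 y
    rw [hgneg, norm_neg] at h
    have h1 := ciInf_le (hPLy x).2.1 ys
    have h2 : g x ≤ f x ys := by rw [hg]; exact ciSup_le hys
    refine le_trans (mul_le_mul_of_nonneg_left ?_ (by positivity)) h
    linarith
  have hnear : ∀ x y, ∃ z, f x z = g x ∧ μy * ‖z - y‖ ^ 2 ≤ 4 * (g x - f x y) := by
    intro x y
    obtain ⟨z, hz, hz'⟩ := exists_minimizer_near_of_PL (h := fun y => -f x y) (m := -g x)
      (hPLy x).1 hμy (fun z => neg_le_neg (hgle x z))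
      (fun z => by rw [hgneg, norm_neg]; linarith [hPL x z]) y
    exact ⟨z, neg_injective hz, by linarith⟩
  have hgradclose : ∀ x y, μy * ‖gradient g x - gradient (fun x' => f x' y) x‖ ^ 2 ≤
      4 * L ^ 2 * (g x - f x y) := by
    intro x y
    obtain ⟨z, hz, hz'⟩ := hnear x y
    rw [hgrad x z (hmax x z hz)]
    have h := hsmooth.2 x x z y
    simp only [sub_self, norm_zero] at h
    have h1 : ‖gradient (fun x' => f x' z) x - gradient (fun x' => f x' y) x‖ ^ 2 ≤
        L ^ 2 * ‖z - y‖ ^ 2 := by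
      nlinarith [sq_nonneg ‖gradient (f x) z - gradient (f x) y‖]
    nlinarith [mul_le_mul_of_nonneg_left h1 hμy.le,
      mul_le_mul_of_nonneg_left hz' (sq_nonneg L)]
  have hglip : ∀ x x', ‖gradient g x - gradient g x'‖ ≤ 2 * L ^ 2 / μy * ‖x - x'‖ := by
    intro x x'
    obtain ⟨w, hw⟩ := hatt x
    obtain ⟨z, hz, hz'⟩ := hnear x' w
    have hcrit : gradient (f x) w = 0 := by
      have : IsLocalMax (f x) w := Filter.Eventually.of_forall hw
      simp [gradient, this.fderiv_eq_zero]
    rw [hgrad x w hw, hgrad x' z (hmax x' z hz)]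
    have h1 := hsmooth.2 x x' w z
    have h2 := hsmooth.2 x x' w w
    rw [hcrit, zero_sub, norm_neg, sub_self, norm_zero] at h2
    have h3 := hPL x' w
    rw [norm_sub_rev z w] at hz'
    refine abs_le_of_sq_le_sq' ?_ (by positivity) |>.2
    set D := ‖x - x'‖
    have h4 : ‖gradient (f x') w‖ ^ 2 ≤ L ^ 2 * D ^ 2 := by
      nlinarith [sq_nonneg ‖gradient (fun x'' => f x'' w) x - gradient (fun x'' => f x'' w) x'‖]
    have h5 : μy ^ 2 * ‖w - z‖ ^ 2 ≤ 2 * (L ^ 2 * D ^ 2) := by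
      nlinarith [mul_le_mul_of_nonneg_left hz' hμy.le]
    have h6 : ‖gradient (fun x'' => f x'' w) x - gradient (fun x'' => f x'' z) x'‖ ^ 2 ≤
        L ^ 2 * (D ^ 2 + ‖w - z‖ ^ 2) := by
      nlinarith [sq_nonneg ‖gradient (f x) w - gradient (f x') z‖]
    have h7 : (2 * L ^ 2 / μy * D) ^ 2 = 4 * L ^ 4 * D ^ 2 / μy ^ 2 := by field_simp; ring
    rw [h7, le_div_iff₀ (by positivity)]
    have h8 : μy ^ 2 ≤ L ^ 2 := pow_le_pow_left₀ hμy.le hμyL 2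
    have h9 : L ^ 2 * D ^ 2 * μy ^ 2 ≤ L ^ 2 * D ^ 2 * L ^ 2 :=
      mul_le_mul_of_nonneg_left h8 (by positivity)
    nlinarith [mul_le_mul_of_nonneg_left h5 (sq_nonneg L),
      mul_le_mul_of_nonneg_right h6 (sq_nonneg μy), mul_nonneg (sq_nonneg (L ^ 2)) (sq_nonneg D)]
  have hτx' : τx = μy ^ 2 / (72 * L ^ 3) := by
    rw [hτx, hτy, hlam]; field_simp; ring
  have hτpos : 0 < τx := by rw [hτx']; positivity
  have hweight : lam * τx / τy = 1 / 18 := by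
    rw [hτx, hτy, hlam]; field_simp
  have hstep : ∀ k, τx / 4 * ‖gradient g (x k)‖ ^ 2 ≤
      (g (x k) + 1 / 18 * (g (x k) - f (x k) (y k))) -
        (g (x (k + 1)) + 1 / 18 * (g (x (k + 1)) - f (x (k + 1)) (y (k + 1)))) := by
    intro k
    have hd := descent_of_gradient_lipschitz hgdiff hglip (x k)
      (-(τx • gradient (fun x' => f x' (y k)) (x k)))
    have hf := hsmooth.quadratic_lower_bound hL.le (x k)
      (-(τx • gradient (fun x' => f x' (y k)) (x k))) (y k) (τy • gradient (f (x k)) (y k))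
    have hc := hgradclose (x k) (y k)
    have hp := hPL (x k) (y k)
    have hb := hgle (x k) (y k)
    rw [← sub_eq_add_neg, ← hxiter, norm_neg, norm_smul, Real.norm_of_nonneg hτpos.le,
      inner_neg_right, inner_smul_right] at hd
    rw [← sub_eq_add_neg, ← hxiter, ← hyiter, norm_neg, norm_smul, norm_smul,
      Real.norm_of_nonneg hτpos.le, inner_neg_right, inner_smul_right, inner_smul_right,
      real_inner_self_eq_norm_sq, real_inner_self_eq_norm_sq, hτy,
      Real.norm_of_nonneg (by positivity)] at hf
    rw [norm_sub_sq_real] at hc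
    exact lyapunov_decrease hL hμy hμyL hτx' hb hd hf hp hc
  intro K hK
  have hsum : τx / 4 * ∑ k ∈ Finset.range K, ‖gradient g (x k)‖ ^ 2 ≤
      (g (x 0) + 1 / 18 * (g (x 0) - f (x 0) (y 0))) -
        (g (x K) + 1 / 18 * (g (x K) - f (x K) (y K))) := by
    rw [Finset.mul_sum]
    exact (Finset.sum_le_sum fun k _ => hstep k).trans_eq (Finset.sum_range_sub' (fun k =>
      g (x k) + 1 / 18 * (g (x k) - f (x k) (y k))) K)
  have hinf := ciInf_le hbdd (x K)
  have hKle := hgle (x K) (y K)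
  rw [hweight]
  have hK0 : (0 : ℝ) < K := by exact_mod_cast hK
  have hcoef : 288 * L ^ 3 / ((K : ℝ) * μy ^ 2) = 1 / K * (4 / τx) := by
    rw [hτx']; field_simp; ring
  rw [hcoef, mul_assoc]
  refine mul_le_mul_of_nonneg_left ?_ (by positivity)
  rw [div_mul_eq_mul_div, le_div_iff₀ hτpos]
  linarith
end
end

section
/- Let f : ℝ^{d_x} × ℝ^{d_y} → ℝ be L-smooth (L > 0), suppose −f(x, ·) is μ_y-PL for every x (μ_y > 0), suppose for every x the supremum sup_y f(x,y) is attained at a unique point, and suppose inf_x sup_y f(x,y) is finite. Fix u ∈ ℝ^{d_x} and β > L, and define F(x,y) := f(x,y) + (β/2)‖x − u‖². Then F has a unique saddle point, i.e. there exists exactly one pair (x̄, ȳ) with F(x̄, y) ≤ F(x̄, ȳ) ≤ F(x, ȳ) for all x, y. -/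
noncomputable section

/-- Derivative of a differentiable function along a line, in terms of the gradient. -/
theorem hasDerivAt_line_gradient {E : Type*} [NormedAddCommGroup E] [InnerProductSpace ℝ E]
    [CompleteSpace E] {g : E → ℝ} (hg : Differentiable ℝ g) (x v : E) (t : ℝ) :
    HasDerivAt (fun s : ℝ => g (x + s • v)) (inner ℝ (gradient g (x + t • v)) v) t := by
  have hline : HasDerivAt (fun s : ℝ => x + s • v) v t := by
    simpa using ((hasDerivAt_id t).smul_const v).const_add x
  have hgrad := (hg (x + t • v)).hasGradientAt.hasFDerivAt
  simpa [Function.comp_def] using hgrad.comp_hasDerivAt t hline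

/-- If `∇g` is `L`-Lipschitz and `L < β`, then `g + (β/2)‖· - u‖²` is strictly convex. -/
theorem strictConvexOn_add_sq_of_lipschitz_gradient {E : Type*} [NormedAddCommGroup E]
    [InnerProductSpace ℝ E] [CompleteSpace E] {g : E → ℝ} (hg : Differentiable ℝ g) {L β : ℝ}
    (hlip : ∀ x x', ‖gradient g x - gradient g x'‖ ≤ L * ‖x - x'‖) (hβ : L < β) (u : E) :
    StrictConvexOn ℝ Set.univ (fun x => g x + β / 2 * ‖x - u‖ ^ 2) := by
  have hsegment : ∀ x v : E, v ≠ 0 →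
      StrictConvexOn ℝ Set.univ (fun t : ℝ => g (x + t • v) + β / 2 * ‖x + t • v - u‖ ^ 2) := by
    intro x v hv
    have hderiv : ∀ t : ℝ,
        HasDerivAt (fun t : ℝ => g (x + t • v) + β / 2 * ‖x + t • v - u‖ ^ 2)
          (inner ℝ (gradient g (x + t • v)) v + β * inner ℝ (x + t • v - u) v) t := by
      intro t
      have hline : HasDerivAt (fun s : ℝ => x + s • v - u) v t := by
        simpa using (((hasDerivAt_id t).smul_const v).const_add x).sub_const u
      refine ((hasDerivAt_line_gradient hg x v t).add
        (hline.norm_sq.const_mul (β / 2))).congr_deriv ?_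
      ring
    refine StrictMono.strictConvexOn_univ_of_deriv
      (continuous_iff_continuousAt.2 fun t => (hderiv t).continuousAt) ?_
    intro s t hst
    rw [(hderiv s).deriv, (hderiv t).deriv]
    have hcs : inner ℝ (gradient g (x + s • v) - gradient g (x + t • v)) v
        ≤ L * ((t - s) * ‖v‖) * ‖v‖ := by
      refine (real_inner_le_norm _ _).trans (mul_le_mul_of_nonneg_right ?_ (norm_nonneg _))
      refine (hlip _ _).trans_eq ?_
      rw [show x + s • v - (x + t • v) = (s - t) • v by module, norm_smul, Real.norm_eq_abs,
        abs_of_neg (by linarith)]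
      ring
    have hquad : inner ℝ (x + t • v - u) v - inner ℝ (x + s • v - u) v
        = (t - s) * ‖v‖ ^ 2 := by
      rw [← inner_sub_left, show x + t • v - u - (x + s • v - u) = (t - s) • v by module,
        real_inner_smul_left, real_inner_self_eq_norm_sq]
    rw [inner_sub_left] at hcs
    have hpos : 0 < (β - L) * ((t - s) * ‖v‖ ^ 2) := by
      have : 0 < ‖v‖ := norm_pos_iff.2 hv
      have : 0 < t - s := by linarith
      have : 0 < β - L := by linarith
      positivity
    linear_combination hcs + hpos - β * hquad
  refine ⟨convex_univ, ?_⟩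
  intro x _ z _ hxz a b ha hb hab
  have h := (hsegment x (z - x) (sub_ne_zero.2 hxz.symm)).2 (Set.mem_univ (0 : ℝ))
    (Set.mem_univ (1 : ℝ)) zero_ne_one ha hb hab
  have hcomb : x + b • (z - x) = a • x + b • z := by
    rw [← eq_sub_iff_add_eq] at hab
    subst hab
    module
  simpa [hcomb] using h

/-- A PL function with a unique minimizer has quadratic growth around it. -/
theorem IsPL.mul_sq_norm_le {d : ℕ} {h : EuclideanSpace ℝ (Fin d) → ℝ} {μ : ℝ} (hμ : 0 < μ)
    (hPL : IsPL h μ) {y₀ : EuclideanSpace ℝ (Fin d)} (hmin : ∀ y, h y₀ ≤ h y)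
    (huniq : ∀ y, (∀ y', h y ≤ h y') → y = y₀) (y : EuclideanSpace ℝ (Fin d)) :
    μ / 4 * ‖y₀ - y‖ ^ 2 ≤ h y - h y₀ := by
  obtain ⟨hdiff, hbdd, hgrad⟩ := hPL
  have hinf : ⨅ z, h z = h y₀ :=
    le_antisymm (ciInf_le hbdd y₀) (le_ciInf hmin)
  rw [hinf] at hgrad
  set c : ℝ := √μ / 2 with hc
  have hcpos : 0 < c := by positivity
  have hcsq : c ^ 2 = μ / 4 := by rw [hc, div_pow, Real.sq_sqrt hμ.le]; norm_num
  set ψ : EuclideanSpace ℝ (Fin d) → ℝ := fun z => √(h z - h y₀) with hψ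
  have hψcont : Continuous ψ := (hdiff.continuous.sub continuous_const).sqrt
  obtain ⟨z, hz⟩ : ∃ z, ∀ w, ψ z + c * ‖z - y‖ ≤ ψ w + c * ‖w - y‖ := by
    refine Continuous.exists_forall_le
      (hψcont.add (continuous_const.mul (continuous_id.sub continuous_const).norm)) ?_
    refine Filter.tendsto_atTop_mono (fun w => le_add_of_nonneg_left (Real.sqrt_nonneg _)) ?_
    refine Filter.Tendsto.const_mul_atTop hcpos ?_
    simpa only [dist_eq_norm] using tendsto_dist_right_cocompact_atTop y
  have hzy : z = y₀ := by
    by_contra hne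
    have hpos : 0 < h z - h y₀ := by
      refine lt_of_le_of_ne (sub_nonneg.2 (hmin z)) fun heq => hne (huniq z fun y' => ?_)
      linarith [hmin y']
    set v := gradient h z with hv
    have hψpos : 0 < ψ z := Real.sqrt_pos.2 hpos
    have hψsq : ψ z ^ 2 = h z - h y₀ := Real.sq_sqrt hpos.le
    have hPLz : 2 * μ * ψ z ^ 2 ≤ ‖v‖ ^ 2 := by rw [hψsq]; exact hgrad z
    have hvpos : 0 < ‖v‖ := by
      refine lt_of_le_of_ne (norm_nonneg _) fun heq => ?_
      rw [← heq] at hPLz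
      have : 0 < 2 * μ * ψ z ^ 2 := by positivity
      linarith
    have hd : HasDerivAt (fun t : ℝ => ψ (z + t • (-v)) + t * (c * ‖v‖))
        (-‖v‖ ^ 2 / (2 * ψ z) + c * ‖v‖) 0 := by
      have h1 := (hasDerivAt_line_gradient hdiff z (-v) 0).sub_const (h y₀)
      have h2 := h1.sqrt (by simpa using hpos.ne')
      refine (h2.add ((hasDerivAt_id (0 : ℝ)).mul_const (c * ‖v‖))).congr_deriv ?_
      simp [hψ, ← hv]
    have hright : nhdsWithin (0 : ℝ) (Set.Ioi 0) ≤ nhdsWithin 0 {0}ᶜ :=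
      nhdsWithin_mono _ fun t ht => ne_of_gt ht
    have hnonneg : 0 ≤ -‖v‖ ^ 2 / (2 * ψ z) + c * ‖v‖ := by
      refine ge_of_tendsto (hd.tendsto_slope.mono_left hright) ?_
      filter_upwards [self_mem_nhdsWithin] with t (ht : 0 < t)
      rw [slope_def_field]
      refine div_nonneg ?_ (by linarith)
      have hzt := hz (z + t • (-v))
      have htri : ‖z + t • (-v) - y‖ ≤ ‖z - y‖ + t * ‖v‖ := by
        rw [show z + t • (-v) - y = (z - y) - t • v by module]
        refine (norm_sub_le _ _).trans_eq ?_
        rw [norm_smul, Real.norm_of_nonneg ht.le]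
      simp only [zero_smul, add_zero, zero_mul]
      nlinarith
    have hle : ‖v‖ ≤ 2 * c * ψ z := by
      rw [neg_div, neg_add_eq_sub, sub_nonneg, div_le_iff₀ (by positivity)] at hnonneg
      nlinarith
    have hsq : ‖v‖ ^ 2 ≤ (2 * c * ψ z) ^ 2 := pow_le_pow_left₀ hvpos.le hle 2
    have : 0 < μ * ψ z ^ 2 := by positivity
    nlinarith
  have hbound : c * ‖y₀ - y‖ ≤ ψ y := by
    have := hz y
    rw [hzy] at this
    simpa [hψ] using this
  have hsq := pow_le_pow_left₀ (by positivity) hbound 2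
  rwa [mul_pow, hcsq, hψ, Real.sq_sqrt (sub_nonneg.2 (hmin y))] at hsq

/-- Minimax step: if `F` is convex in `x`, `x₀` minimizes `x ↦ F x (Y x)` where `Y x` maximizes
`F x`, and `F x₀` has quadratic growth around its maximizer `Y x₀`, then `x₀` minimizes
`F · (Y x₀)`. -/
theorem le_apply_of_isMin_max {E G : Type*} [AddCommGroup E] [Module ℝ E]
    [NormedAddCommGroup G] {F : E → G → ℝ}
    (hconv : ∀ y, ConvexOn ℝ Set.univ fun x => F x y) (hcont : ∀ x, Continuous (F x))
    {Y : E → G} (hY : ∀ x y, F x y ≤ F x (Y x)) {x₀ : E}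
    (hx₀ : ∀ x, F x₀ (Y x₀) ≤ F x (Y x)) {κ : ℝ} (hκ : 0 < κ)
    (hgrowth : ∀ y, κ * ‖Y x₀ - y‖ ^ 2 ≤ F x₀ (Y x₀) - F x₀ y) (x : E) :
    F x₀ (Y x₀) ≤ F x (Y x₀) := by
  set M := F x₀ (Y x₀) with hM
  set y : ℝ → G := fun t => Y ((1 - t) • x₀ + t • x)
  have hstep : ∀ t, 0 < t → t < 1 → M ≤ (1 - t) * F x₀ (y t) + t * F x (y t) := fun t h0 h1 =>
    (hx₀ _).trans ((hconv (y t)).2 (Set.mem_univ x₀) (Set.mem_univ x) (by linarith) h0.le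
      (by ring))
  have hsmall : ∀ᶠ t : ℝ in nhdsWithin 0 (Set.Ioi 0), 0 < t ∧ t < 1 := by
    filter_upwards [Ioo_mem_nhdsGT (zero_lt_one' ℝ)] with t ht using ht
  have hvalue : ∀ᶠ t : ℝ in nhdsWithin 0 (Set.Ioi 0), M ≤ F x (y t) := by
    filter_upwards [hsmall] with t ⟨h0, h1⟩
    have := hstep t h0 h1
    have := hY x₀ (y t)
    nlinarith
  have hdist : ∀ᶠ t : ℝ in nhdsWithin 0 (Set.Ioi 0),
      ‖Y x₀ - y t‖ ^ 2 ≤ t / (1 - t) * (F x (Y x) - M) / κ := by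
    filter_upwards [hsmall] with t ⟨h0, h1⟩
    have h1t : 0 < 1 - t := by linarith
    rw [le_div_iff₀ hκ, mul_comm]
    refine (hgrowth _).trans ?_
    rw [div_mul_eq_mul_div, le_div_iff₀ h1t]
    have := hstep t h0 h1
    have := hY x (y t)
    nlinarith
  have hbound : Filter.Tendsto (fun t : ℝ => t / (1 - t) * (F x (Y x) - M) / κ)
      (nhdsWithin 0 (Set.Ioi 0)) (nhds 0) := by
    have hc : ContinuousAt (fun t : ℝ => t / (1 - t) * (F x (Y x) - M) / κ) 0 := by
      have : (1 : ℝ) - 0 ≠ 0 := by norm_num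
      fun_prop (disch := assumption)
    simpa using hc.tendsto.mono_left nhdsWithin_le_nhds
  have hsq := squeeze_zero' (Filter.Eventually.of_forall fun t => sq_nonneg _) hdist hbound
  have hlim : Filter.Tendsto y (nhdsWithin 0 (Set.Ioi 0)) (nhds (Y x₀)) := by
    rw [tendsto_iff_norm_sub_tendsto_zero]
    have hsqrt := hsq.sqrt
    simpa [Real.sqrt_sq (norm_nonneg _), norm_sub_rev] using hsqrt
  exact ge_of_tendsto (((hcont x).tendsto _).comp hlim) hvalue

/-- A function strictly convex in `x` with a unique maximizer in `y` for each `x` has at most one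
saddle point. -/
theorem IsSaddle.unique {dx dy : ℕ}
    {F : EuclideanSpace ℝ (Fin dx) → EuclideanSpace ℝ (Fin dy) → ℝ}
    (hconv : ∀ y, StrictConvexOn ℝ Set.univ fun x => F x y)
    (huniq : ∀ x y z, (∀ y', F x y' ≤ F x y) → (∀ y', F x y' ≤ F x z) → y = z)
    {p q : EuclideanSpace ℝ (Fin dx) × EuclideanSpace ℝ (Fin dy)}
    (hp : IsSaddle F p) (hq : IsSaddle F q) : p = q := by
  have h1 := hp q.1 q.2
  have h2 := hq p.1 p.2
  have hx : p.1 = q.1 := (hconv p.2).eq_of_isMinOn (fun x _ => (hp x p.2).2)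
    (fun x _ => by
      have := (hp x p.2).2
      change F q.1 p.2 ≤ F x p.2
      linarith) (Set.mem_univ _) (Set.mem_univ _)
  have hy : p.2 = q.2 := huniq p.1 _ _ (fun y => (hp p.1 y).1) (fun y => by
    have := (hp p.1 y).1
    linarith)
  exact Prod.ext hx hy

theorem stmt11 {dx dy : ℕ} (f : EuclideanSpace ℝ (Fin dx) → EuclideanSpace ℝ (Fin dy) → ℝ)
    (L μy : ℝ) (hL : 0 < L) (hμy : 0 < μy)
    (hsmooth : LSmooth f L)
    (hPLy : ∀ x, IsPL (fun y => -f x y) μy)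
    (hatt : ∀ x, ∃! y, ∀ y', f x y' ≤ f x y)
    (hbdd : BddBelow (Set.range fun x => ⨆ y, f x y))
    (u : EuclideanSpace ℝ (Fin dx)) (β : ℝ) (hβ : L < β)
    (F : EuclideanSpace ℝ (Fin dx) → EuclideanSpace ℝ (Fin dy) → ℝ) (hF : ∀ x y, F x y = f x y + β / 2 * ‖x - u‖ ^ 2) :
    ∃! p : EuclideanSpace ℝ (Fin dx) × EuclideanSpace ℝ (Fin dy), IsSaddle F p := by
  obtain ⟨hdiff, hlip⟩ := hsmooth
  have hdiffx : ∀ y, Differentiable ℝ fun x => f x y := fun y =>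
    hdiff.comp (differentiable_id.prodMk (differentiable_const y))
  have hdiffy : ∀ x, Differentiable ℝ (f x) := fun x =>
    hdiff.comp ((differentiable_const x).prodMk differentiable_id)
  have hconv : ∀ y, StrictConvexOn ℝ Set.univ fun x => F x y := by
    intro y
    simp only [hF]
    refine strictConvexOn_add_sq_of_lipschitz_gradient (hdiffx y) (fun x x' => ?_) hβ u
    have h := hlip x x' y y
    simp only [sub_self, norm_zero] at h
    refine le_of_sq_le_sq ?_ (by positivity)
    nlinarith [sq_nonneg ‖gradient (f x) y - gradient (f x') y‖]
  have hcontx : ∀ y, Continuous fun x => F x y := fun y => by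
    have := (hdiffx y).continuous
    simp only [hF]
    fun_prop
  have hconty : ∀ x, Continuous (F x) := fun x => by
    have := (hdiffy x).continuous
    rw [funext (hF x)]
    fun_prop
  choose Y hY hYuniq using hatt
  have hFY : ∀ x y, F x y ≤ F x (Y x) := fun x y => by simpa [hF] using hY x y
  have hFuniq : ∀ x y, (∀ y', F x y' ≤ F x y) → y = Y x := fun x y hy =>
    hYuniq x y fun y' => by simpa [hF] using hy y'
  obtain ⟨m, hm⟩ := hbdd
  have hlower : ∀ x, m + β / 2 * ‖x - u‖ ^ 2 ≤ F x (Y x) := fun x => by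
    have hsup : m ≤ ⨆ y, f x y := hm ⟨x, rfl⟩
    have : ⨆ y, f x y ≤ f x (Y x) := ciSup_le (hY x)
    rw [hF]
    linarith
  have hlsc : LowerSemicontinuous fun x => F x (Y x) := fun x a ha => by
    filter_upwards [(hcontx (Y x)).continuousAt.eventually (lt_mem_nhds ha)] with z hz
    exact lt_of_lt_of_le hz (hFY z _)
  obtain ⟨x₀, hx₀⟩ : ∃ x₀, ∀ x, F x₀ (Y x₀) ≤ F x (Y x) := by
    have hβpos : 0 < β / 2 := by linarith
    have htend : Filter.Tendsto (fun x => F x (Y x)) (Filter.cocompact _) Filter.atTop := by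
      refine Filter.tendsto_atTop_mono hlower (Filter.tendsto_atTop_add_const_left _ _ ?_)
      refine Filter.Tendsto.const_mul_atTop hβpos
        ((Filter.tendsto_pow_atTop two_ne_zero).comp ?_)
      simpa only [dist_eq_norm] using tendsto_dist_right_cocompact_atTop u
    obtain ⟨K, hK, hKsub⟩ := Filter.mem_cocompact.1 (htend.eventually_ge_atTop (F u (Y u)))
    obtain ⟨x₀, -, hmin⟩ := (hlsc.lowerSemicontinuousOn (insert u K)).exists_isMinOn
      (Set.insert_nonempty u K) (hK.insert u)
    refine ⟨x₀, fun x => ?_⟩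
    by_cases hx : x ∈ K
    · exact hmin (Set.mem_insert_of_mem u hx)
    · exact le_trans (hmin (Set.mem_insert u K)) (hKsub hx)
  have hgrowth : ∀ y, μy / 4 * ‖Y x₀ - y‖ ^ 2 ≤ F x₀ (Y x₀) - F x₀ y := fun y => by
    have h := (hPLy x₀).mul_sq_norm_le hμy (y₀ := Y x₀) (fun y => neg_le_neg (hY x₀ y))
      (fun y hy => hYuniq x₀ y fun y' => neg_le_neg_iff.1 (hy y')) y
    rw [hF, hF]
    linarith
  have hsaddle : IsSaddle F (x₀, Y x₀) := fun x y =>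
    ⟨hFY x₀ y, le_apply_of_isMin_max (fun y => (hconv y).convexOn) hconty hFY hx₀
      (by positivity : 0 < μy / 4) hgrowth x⟩
  exact ⟨_, hsaddle, fun q hq => hq.unique hconv
    (fun x y z hy hz => (hFuniq x y hy).trans (hFuniq x z hz).symm) hsaddle⟩
end
end

section
/- Let f : ℝ^{d_x} × ℝ^{d_y} → ℝ be L-smooth (L > 0), fix u ∈ ℝ^{d_x} and β > L, and define F(x,y) := f(x,y) + (β/2)‖x − u‖². Let (x̃, ỹ) be a saddle point of F, and let δ ≥ 0 and x ∈ ℝ^{d_x} satisfy ‖x − x̃‖² ≤ δ. Then F(x, ỹ) − F(x̃, ỹ) ≤ (β+L)² δ / (2(β−L)). -/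
noncomputable section

/-- Descent lemma: a differentiable function whose gradient at any point `z` differs from the one
at `a` by at most `L * ‖z - a‖` is bounded above by its quadratic model at `a`. -/
theorem le_quadratic_model_of_norm_gradient_sub_le {E : Type*} [NormedAddCommGroup E]
    [InnerProductSpace ℝ E] [CompleteSpace E] {h : E → ℝ} {L : ℝ} {a : E}
    (hd : Differentiable ℝ h)
    (hlip : ∀ z, ‖gradient h z - gradient h a‖ ≤ L * ‖z - a‖) (x : E) :
    h x ≤ h a + inner ℝ (gradient h a) (x - a) + L / 2 * ‖x - a‖ ^ 2 := by
  set v := x - a with hv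
  have hderiv : ∀ t : ℝ, HasDerivAt
      (fun t : ℝ => h (a + t • v) - t * inner ℝ (gradient h a) v - L / 2 * ‖v‖ ^ 2 * t ^ 2)
      (inner ℝ (gradient h (a + t • v)) v - inner ℝ (gradient h a) v - L * ‖v‖ ^ 2 * t) t := by
    intro t
    have hline : HasDerivAt (fun t : ℝ => a + t • v) v t := by
      simpa using ((hasDerivAt_id t).smul_const v).const_add a
    have hcomp : HasDerivAt (fun t : ℝ => h (a + t • v))
        (inner ℝ (gradient h (a + t • v)) v) t := by
      simpa [Function.comp_def] using
        (hd (a + t • v)).hasGradientAt.hasFDerivAt.comp_hasDerivAt t hline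
    refine ((hcomp.sub ((hasDerivAt_id t).mul_const (inner ℝ (gradient h a) v))).sub
      ((hasDerivAt_pow 2 t).const_mul (L / 2 * ‖v‖ ^ 2))).congr_deriv ?_
    norm_num
    ring
  have hanti := antitoneOn_of_hasDerivWithinAt_nonpos (convex_Icc (0 : ℝ) 1)
    (fun t _ => (hderiv t).continuousAt.continuousWithinAt)
    (fun t _ => (hderiv t).hasDerivWithinAt) (fun t ht => by
      rw [interior_Icc] at ht
      have hbound := hlip (a + t • v)
      rw [add_sub_cancel_left, norm_smul, Real.norm_of_nonneg ht.1.le] at hbound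
      have hcs := real_inner_le_norm (gradient h (a + t • v) - gradient h a) v
      rw [inner_sub_left] at hcs
      nlinarith [mul_le_mul_of_nonneg_right hbound (norm_nonneg v)])
  have hle := hanti (Set.left_mem_Icc.2 zero_le_one) (Set.right_mem_Icc.2 zero_le_one) zero_le_one
  have hax : a + v = x := by rw [hv]; abel
  simp only [one_smul, zero_smul, add_zero, hax] at hle
  linarith

theorem stmt12 {dx dy : ℕ} (f : EuclideanSpace ℝ (Fin dx) → EuclideanSpace ℝ (Fin dy) → ℝ)
    (L : ℝ) (hL : 0 < L)
    (hsmooth : LSmooth f L)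
    (u : EuclideanSpace ℝ (Fin dx)) (β : ℝ) (hβ : L < β)
    (F : EuclideanSpace ℝ (Fin dx) → EuclideanSpace ℝ (Fin dy) → ℝ) (hF : ∀ x y, F x y = f x y + β / 2 * ‖x - u‖ ^ 2)
    (p : EuclideanSpace ℝ (Fin dx) × EuclideanSpace ℝ (Fin dy)) (hsaddle : IsSaddle F p)
    (δ : ℝ) (hδ : 0 ≤ δ) (x : EuclideanSpace ℝ (Fin dx)) (hx : ‖x - p.1‖ ^ 2 ≤ δ) :
    F x p.2 - F p.1 p.2 ≤ (β + L) ^ 2 * δ / (2 * (β - L)) := by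
  obtain ⟨a, b⟩ := p
  dsimp only at *
  have hd : Differentiable ℝ (fun z => f z b) :=
    hsmooth.1.comp (differentiable_id.prodMk (differentiable_const b))
  have hlip : ∀ z, ‖gradient (fun w => f w b) z - gradient (fun w => f w b) a‖ ≤ L * ‖z - a‖ := by
    intro z
    have hsq := hsmooth.2 z a b b
    rw [sub_self b, norm_zero] at hsq
    refine abs_le_of_sq_le_sq' ?_ (by positivity) |>.2
    nlinarith [sq_nonneg ‖gradient (f z) b - gradient (f a) b‖]
  have hdescent := le_quadratic_model_of_norm_gradient_sub_le hd hlip x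
  have hcrit : inner ℝ (gradient (fun w => f w b) a) (x - a) + β * inner ℝ (a - u) (x - a) = 0 := by
    have hmin : IsLocalMin (fun z => f z b + β / 2 * ‖z - u‖ ^ 2) a :=
      Filter.Eventually.of_forall fun z => by
        simpa only [hF] using (hsaddle z b).2
    have hfd := (hd a).hasGradientAt.hasFDerivAt.add
      ((((hasFDerivAt_id a).sub_const u).norm_sq).const_mul (β / 2))
    have hzero : inner ℝ (gradient (fun w => f w b) a) (x - a)
        + β / 2 * (2 * inner ℝ (a - u) (x - a)) = 0 := by
      simpa [inner_sub_left] using congrArg (fun T => T (x - a)) (hmin.hasFDerivAt_eq_zero hfd)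
    linarith
  have hnorm : ‖x - u‖ ^ 2 = ‖x - a‖ ^ 2 + 2 * inner ℝ (a - u) (x - a) + ‖a - u‖ ^ 2 := by
    rw [← sub_add_sub_cancel x a u, norm_add_sq_real, real_inner_comm]
  have hupper : F x b - F a b ≤ (β + L) / 2 * δ := by
    rw [hF, hF, hnorm]
    nlinarith
  refine hupper.trans ?_
  rw [le_div_iff₀ (by linarith)]
  nlinarith [mul_nonneg (mul_nonneg (by linarith : 0 ≤ β + L) hL.le) hδ]
end
end
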